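/- Let 0 < p ≤ q < ∞, let ω, ν ∈ D be radial weights with ω̂, ν̂ > 0 on [0,1), let α(ω) > 0 be a Ď-exponent of ω and β(ω) > 0 a D̂-exponent of ω, and let f ∈ L^q_ν. Then the following are equivalent: (a) there exists r_0 = r_0(ν) > 0 such that for all r ≥ r_0, ν(Δ(z,r)) > 0 for all z ∈ 𝔻 and sup_{z∈𝔻} γ(z)·((1/ν(Δ(z,r))) ∫_{Δ(z,r)} |f(ζ)|^q ν(ζ) dA(ζ))^{1/q} < ∞; (b) the multiplication operator M_f(g) = f g is bounded from A^p_ω to L^q_ν, i.e. there is C > 0 with ∫_𝔻 |g|^q |f|^q ν dA ≤ C ∥g∥^q_{A^p_ω} for all g ∈ A^p_ω; (c) for every σ > 1 − (q/p)(1 + α(ω)) and every c > max{−1−σ, (q/p)(1 + β(ω)) − 2}, sup_{z∈𝔻} γ(z)^q · B_{ν,c,σ}(|f|^q)(z) < ∞. -/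

import Mathlib

open MeasureTheory Set
open scoped ENNReal ComplexConjugate

noncomputable section

/-- The open unit disc in `ℂ`. -/
def UD : Set ℂ := Metric.ball (0 : ℂ) 1

/-- Normalized area measure `dA = dx dy / π` on `ℂ`. -/
def dA : Measure ℂ := (ENNReal.ofReal Real.pi)⁻¹ • (MeasureTheory.volume : Measure ℂ)

/-- `ω̂(r) = ∫_r^1 ω(s) ds` for a (radial) weight `ω : ℂ → ℝ`. -/
def what (ω : ℂ → ℝ) (r : ℝ) : ℝ := ∫ s in r..(1 : ℝ), ω (s : ℂ)

/-- A radial weight: nonnegative, radial, integrable over the unit disc. -/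
def RadialWeight (ω : ℂ → ℝ) : Prop :=
  (∀ z, 0 ≤ ω z) ∧ (∀ z : ℂ, ω z = ω ((‖z‖ : ℝ) : ℂ)) ∧ IntegrableOn ω UD dA

/-- `ω̂ > 0` on `[0,1)`. -/
def WhatPos (ω : ℂ → ℝ) : Prop := ∀ r : ℝ, 0 ≤ r → r < 1 → 0 < what ω r

/-- The class `D̂`. -/
def Dhat (ω : ℂ → ℝ) : Prop :=
  ∃ C > (1 : ℝ), ∀ r : ℝ, 0 ≤ r → r < 1 → what ω r ≤ C * what ω ((1 + r) / 2)

/-- The class `Ď`. -/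
def Dcheck (ω : ℂ → ℝ) : Prop :=
  ∃ K > (1 : ℝ), ∃ C > (1 : ℝ), ∀ r : ℝ, 0 ≤ r → r < 1 →
    C * what ω (1 - (1 - r) / K) ≤ what ω r

/-- The class `D = D̂ ∩ Ď`. -/
def Dclass (ω : ℂ → ℝ) : Prop := Dhat ω ∧ Dcheck ω

/-- A `Ď`-exponent `α > 0` for `ω`: `ω̂(t) ≤ C ((1-t)/(1-r))^α ω̂(r)` for `0 ≤ r ≤ t < 1`. -/
def DcheckExp (ω : ℂ → ℝ) (α : ℝ) : Prop :=
  ∃ C > (0 : ℝ), ∀ r t : ℝ, 0 ≤ r → r ≤ t → t < 1 →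
    what ω t ≤ C * ((1 - t) / (1 - r)) ^ α * what ω r

/-- A `D̂`-exponent `β > 0` for `ω`: `ω̂(r) ≤ C ((1-r)/(1-t))^β ω̂(t)` for `0 ≤ r ≤ t < 1`. -/
def DhatExp (ω : ℂ → ℝ) (β : ℝ) : Prop :=
  ∃ C > (0 : ℝ), ∀ r t : ℝ, 0 ≤ r → r ≤ t → t < 1 →
    what ω r ≤ C * ((1 - r) / (1 - t)) ^ β * what ω t

/-- Weighted `L^p` "norm" over the unit disc. -/
def wnorm (p : ℝ) (ω : ℂ → ℝ) (f : ℂ → ℂ) : ℝ :=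
  (∫ z in UD, ‖f z‖ ^ p * ω z ∂dA) ^ (1 / p)

/-- Membership in the weighted Lebesgue space `L^p_ω`. -/
def MemLw (p : ℝ) (ω : ℂ → ℝ) (f : ℂ → ℂ) : Prop :=
  AEStronglyMeasurable f (dA.restrict UD) ∧
  IntegrableOn (fun z => ‖f z‖ ^ p * ω z) UD dA

/-- Membership in the weighted Bergman space `A^p_ω`. -/
def MemAp (p : ℝ) (ω : ℂ → ℝ) (f : ℂ → ℂ) : Prop :=
  DifferentiableOn ℂ f UD ∧ IntegrableOn (fun z => ‖f z‖ ^ p * ω z) UD dA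

/-- `H^∞`: bounded analytic functions on the unit disc. -/
def Hinfty (f : ℂ → ℂ) : Prop :=
  DifferentiableOn ℂ f UD ∧ ∃ M : ℝ, ∀ z ∈ UD, ‖f z‖ ≤ M

/-- Moments `ν_x = ∫_0^1 t^x ν(t) dt`. -/
def mom (ν : ℂ → ℝ) (x : ℝ) : ℝ := ∫ t in (0 : ℝ)..1, t ^ x * ν (t : ℂ)

/-- The Bergman reproducing kernel of `A²_ν`. -/
def Bker (ν : ℂ → ℝ) (z ζ : ℂ) : ℂ :=
  ∑' n : ℕ, (ζ * conj z) ^ n / (((2 * mom ν (2 * (n : ℝ) + 1) : ℝ)) : ℂ)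

/-- The Bergman projection `P_ν`. -/
def Pw (ν : ℂ → ℝ) (f : ℂ → ℂ) (z : ℂ) : ℂ :=
  ∫ ζ in UD, f ζ * conj (Bker ν z ζ) * ((ν ζ : ℝ) : ℂ) ∂dA

/-- The Hankel operator `H_f^ν(g) = f g − P_ν(f g)`. -/
def Hankel (ν : ℂ → ℝ) (f g : ℂ → ℂ) (z : ℂ) : ℂ :=
  f z * g z - Pw ν (fun ζ => f ζ * g ζ) z

/-- The standard weighted Bergman projection `P_η`. -/
def Pstd (η : ℝ) (f : ℂ → ℂ) (z : ℂ) : ℂ :=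
  (((η + 1 : ℝ)) : ℂ) *
    ∫ ζ in UD, f ζ * (((1 - ‖ζ‖ ^ 2) ^ η : ℝ) : ℂ) *
      (1 - z * conj ζ) ^ (((-(2 + η) : ℝ)) : ℂ) ∂dA

/-- The Bekollé–Bonami class `B_q` (for radial weights). -/
def Bq (q : ℝ) (ν : ℂ → ℝ) : Prop :=
  ∃ η > (-1 : ℝ), ∃ C > (0 : ℝ), ∀ f : ℂ → ℂ, MemLw q ν f →
    wnorm q ν (Pstd η f) ≤ C * wnorm q ν f

/-- Pseudo-hyperbolic distance. -/
def pd (z ζ : ℂ) : ℝ := ‖(z - ζ) / (1 - conj z * ζ)‖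

/-- Hyperbolic distance `β(z,ζ)`. -/
def hyp (z ζ : ℂ) : ℝ := (1 / 2) * Real.log ((1 + pd z ζ) / (1 - pd z ζ))

/-- The hyperbolic disc `Δ(z,r)`. -/
def hDisc (z : ℂ) (r : ℝ) : Set ℂ := {ζ ∈ UD | hyp z ζ < r}

/-- `ν(Δ(z,r))`. -/
def nuD (ν : ℂ → ℝ) (z : ℂ) (r : ℝ) : ℝ := ∫ ζ in hDisc z r, ν ζ ∂dA

/-- The function `γ(z)`. -/
def gam (ω ν : ℂ → ℝ) (p q : ℝ) (z : ℂ) : ℝ :=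
  (what ν ‖z‖) ^ (1 / q) * (1 - ‖z‖) ^ (1 / q) /
    ((what ω ‖z‖) ^ (1 / p) * (1 - ‖z‖) ^ (1 / p))

/-- The average `f̂_{r,ν}(z)`. -/
def havg (ν : ℂ → ℝ) (r : ℝ) (f : ℂ → ℂ) (z : ℂ) : ℂ :=
  (∫ ζ in hDisc z r, ν ζ • f ζ ∂dA) / ((nuD ν z r : ℝ) : ℂ)

/-- The mean oscillation `MO_{ν,q,r}(f)(z)`. -/
def MO (ν : ℂ → ℝ) (q r : ℝ) (f : ℂ → ℂ) (z : ℂ) : ℝ :=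
  ((∫ ζ in hDisc z r, ‖f ζ - havg ν r f z‖ ^ q * ν ζ ∂dA) / nuD ν z r) ^ (1 / q)

/-- Finiteness of the `BMO(Δ)_{ω,ν,p,q,r}` norm. -/
def BMOfin (ω ν : ℂ → ℝ) (p q r : ℝ) (f : ℂ → ℂ) : Prop :=
  ∃ M : ℝ, ∀ z ∈ UD, MO ν q r f z * gam ω ν p q z ≤ M

/-- Boundedness of the Hankel operator `H_f^ν : A^p_ω → L^q_ν` tested on `H^∞`. -/
def HankelBdd (p q : ℝ) (ω ν : ℂ → ℝ) (f : ℂ → ℂ) : Prop :=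
  ∃ C > (0 : ℝ), ∀ g : ℂ → ℂ, Hinfty g → wnorm q ν (Hankel ν f g) ≤ C * wnorm p ω g

/-- `ω̂` extended by the convention `ω̂(t) = ω̂(0)` for `t < 0`. -/
def whatE (ω : ℂ → ℝ) (t : ℝ) : ℝ := what ω (max t 0)

/-- The function `Γ_τ(z,ζ)`. -/
def Gam (ω ν : ℂ → ℝ) (p q τ : ℝ) (z ζ : ℂ) : ℝ :=
  ((‖1 - conj z * ζ‖ ^ 2 / max (1 - ‖z‖ ^ 2) (1 - ‖ζ‖ ^ 2)) ^ (1 / p - (τ + 1) / q) *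
      whatE ω (1 - 2 * ‖1 - conj z * ζ‖ ^ 2 / max (1 - ‖z‖ ^ 2) (1 - ‖ζ‖ ^ 2)) ^ (1 / p)) /
    (min (what ν ‖z‖ / (1 - ‖z‖) ^ τ) (what ν ‖ζ‖ / (1 - ‖ζ‖) ^ τ)) ^ (1 / q)

/-- The generalized Berezin transform `B_{ν,c,σ}(φ)(z)` of a real-valued `φ`. -/
def Ber (ν : ℂ → ℝ) (c σ : ℝ) (φ : ℂ → ℝ) (z : ℂ) : ℝ :=
  (1 - ‖z‖ ^ 2) ^ (c + 1) / what ν ‖z‖ *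
    ∫ ζ in UD, φ ζ * (1 - ‖ζ‖ ^ 2) ^ σ * ‖1 - z * conj ζ‖ ^ (-(2 + c + σ)) * ν ζ ∂dA

/-- The operator `T_{b,c}`. -/
def Tbc (b c : ℝ) (f : ℂ → ℂ) (z : ℂ) : ℂ :=
  ∫ ζ in UD, f ζ * (((1 - ‖ζ‖ ^ 2) ^ b : ℝ) : ℂ) * (1 - z * conj ζ) ^ (((-c : ℝ)) : ℂ) ∂dA

/-- The operator `S_{b,c}`. -/
def Sbc (b c : ℝ) (f : ℂ → ℂ) (z : ℂ) : ℂ :=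
  ∫ ζ in UD, f ζ * ((((1 - ‖ζ‖ ^ 2) ^ b * ‖1 - z * conj ζ‖ ^ (-c)) : ℝ) : ℂ) ∂dA

/-- The standard kernel `B^η_z(ζ) = (1 − conj(z) ζ)^{−(2+η)}`. -/
def Bstd (η : ℝ) (z ζ : ℂ) : ℂ := (1 - conj z * ζ) ^ (((-(2 + η) : ℝ)) : ℂ)

/-- The normalized kernel `b^η_{z,ω}`. -/
def bnrm (p : ℝ) (ω : ℂ → ℝ) (η : ℝ) (z ζ : ℂ) : ℂ :=
  Bstd η z ζ / ((wnorm p ω (Bstd η z) : ℝ) : ℂ)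

/-- The function `g^η_{z,ω} = P_ν(conj(f) b^η_{z,ω}) / b^η_{z,ω}`. -/
def gfn (ν : ℂ → ℝ) (p : ℝ) (ω : ℂ → ℝ) (η : ℝ) (f : ℂ → ℂ) (z ζ : ℂ) : ℂ :=
  Pw ν (fun u => conj (f u) * bnrm p ω η z u) ζ / bnrm p ω η z ζ

end

/-- Sub-mean value property of `|g|^p` for analytic `g` and any `p > 0`. -/
theorem norm_rpow_le_circleAverage {g : ℂ → ℂ} {c : ℂ} {R p : ℝ} (hR : 0 < R) (hp : 0 < p)
    (hg : AnalyticOnNhd ℂ g (Metric.closedBall c R)) :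
    ‖g c‖ ^ p ≤ Real.circleAverage (fun z => ‖g z‖ ^ p) c R := by
  have hgc : ContinuousOn g (Metric.sphere c |R|) := by
    rw [abs_of_pos hR]; exact hg.continuousOn.mono Metric.sphere_subset_closedBall
  have hint : CircleIntegrable (fun z => ‖g z‖ ^ p) c R := by
    apply ContinuousOn.circleIntegrable'
    exact hgc.norm.rpow_const (fun _ _ => Or.inr hp.le)
  by_cases h0 : g c = 0
  · rw [h0, norm_zero, Real.zero_rpow hp.ne']
    exact Real.circleAverage_nonneg_of_nonneg (fun x _ => by positivity)
  have habs : |R| = R := abs_of_pos hR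
  have hga : AnalyticOnNhd ℂ g (Metric.closedBall c |R|) := by rwa [habs]
  have hgs : AnalyticOnNhd ℂ g (Metric.sphere c |R|) :=
    hga.mono Metric.sphere_subset_closedBall
  have hlogint : CircleIntegrable (fun z => Real.log ‖g z‖) c R :=
    MeromorphicOn.circleIntegrable_log_norm hgs.meromorphicOn
  have hlog : Real.log ‖g c‖ ≤ Real.circleAverage (fun z => Real.log ‖g z‖) c R := by
    rw [AnalyticOnNhd.circleAverage_log_norm hR.ne' hga h0]
    have : 0 ≤ ∑ᶠ u, (MeromorphicOn.divisor g (Metric.closedBall c |R|) u : ℝ)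
        * Real.log (R * ‖c - u‖⁻¹) := by
      apply finsum_nonneg
      intro u
      by_cases hu : u ∈ Metric.closedBall c |R|
      · apply mul_nonneg
        · exact_mod_cast (MeromorphicOn.AnalyticOnNhd.divisor_nonneg hga) u
        · rcases eq_or_ne c u with rfl | hcu
          · simp
          · apply Real.log_nonneg
            have : 0 < ‖c - u‖ := norm_pos_iff.mpr (sub_ne_zero.mpr hcu)
            rw [← div_eq_mul_inv, le_div_iff₀ this, one_mul, ← dist_eq_norm, dist_comm]
            rw [habs] at hu
            exact hu
      · simp [hu]
    linarith
  have hcod : {z | g z ≠ 0} ∈ Filter.codiscreteWithin (Metric.sphere c |R|) := by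
    have := hga.preimage_zero_mem_codiscreteWithin h0 (by simp)
      ((convex_closedBall c |R|).isConnected ⟨c, by simp⟩)
    apply Filter.codiscreteWithin_mono Metric.sphere_subset_closedBall
    filter_upwards [this] with z hz
    simpa using hz
  set m := Real.log ‖g c‖
  have hpos : 0 < ‖g c‖ := norm_pos_iff.mpr h0
  have hcongr : Real.circleAverage (fun z => ‖g z‖ ^ p) c R =
      Real.circleAverage (fun z => if g z = 0 then ‖g c‖ ^ p * (1 + p * (Real.log ‖g z‖ - m))
        else ‖g z‖ ^ p) c R := by
    apply Real.circleAverage_congr_codiscreteWithin _ hR.ne'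
    filter_upwards [hcod] with z hz
    rw [if_neg hz]
  have hint2 : CircleIntegrable (fun z => if g z = 0 then
      ‖g c‖ ^ p * (1 + p * (Real.log ‖g z‖ - m)) else ‖g z‖ ^ p) c R := by
    apply CircleIntegrable.congr_codiscreteWithin _ hint
    filter_upwards [hcod] with z hz
    rw [if_neg hz]
  have hint3 : CircleIntegrable (fun z => ‖g c‖ ^ p * (1 + p * (Real.log ‖g z‖ - m))) c R := by
    have h1 : CircleIntegrable (fun z => ‖g c‖ ^ p * p * Real.log ‖g z‖ ) c R := by
      simpa using! CircleIntegrable.const_smul (a := ‖g c‖ ^ p * p) hlogint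
    have h2 := h1.add (circleIntegrable_const (‖g c‖ ^ p * (1 - p * m)) c R)
    refine h2.congr ?_
    intro x _
    simp only [Pi.add_apply]
    ring
  rw [hcongr]
  have hm := Real.circleAverage_mono hint3 hint2 (by
    intro z hz
    split_ifs with h
    · rfl
    · have hz : 0 < ‖g z‖ := norm_pos_iff.mpr h
      have e1 : ‖g z‖ ^ p = ‖g c‖ ^ p * Real.exp (p * (Real.log ‖g z‖ - m)) := by
        rw [Real.rpow_def_of_pos hz, Real.rpow_def_of_pos hpos, ← Real.exp_add]
        congr 1; ring
      rw [e1]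
      gcongr
      linarith [Real.add_one_le_exp (p * (Real.log ‖g z‖ - m))])
  refine le_trans ?_ hm
  have e2 : Real.circleAverage (fun z => ‖g c‖ ^ p * (1 + p * (Real.log ‖g z‖ - m))) c R
      = ‖g c‖ ^ p * (1 + p * (Real.circleAverage (fun z => Real.log ‖g z‖) c R - m)) := by
    have : (fun z => ‖g c‖ ^ p * (1 + p * (Real.log ‖g z‖ - m))) =
      (fun z => (‖g c‖ ^ p * p) • Real.log ‖g z‖) + (fun _ => ‖g c‖ ^ p * (1 - p * m)) := by
      ext z; simp only [Pi.add_apply, smul_eq_mul]; ring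
    rw [this, Real.circleAverage_add, Real.circleAverage_fun_smul, Real.circleAverage_const]
    · simp only [smul_eq_mul]; ring
    · exact CircleIntegrable.const_smul hlogint
    · exact circleIntegrable_const _ _ _
  rw [e2]
  have : 0 < ‖g c‖ ^ p := Real.rpow_pos_of_pos hpos p
  have : 0 ≤ p * (Real.circleAverage (fun z => Real.log ‖g z‖) c R - m) :=
    mul_nonneg hp.le (by linarith)
  nlinarith

/-- Circle means of a rotationally stable submean function increase with the radius. -/
theorem circleAverage_mono_radius {U : ℂ → ℝ} (hU : Continuous U) {s : ℝ}
    (hsub : ∀ u : ℂ, ‖u‖ = 1 → ∀ c : ℂ, ∀ R : ℝ, 0 < R → ‖c‖ + R ≤ s →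
      U (c * u) ≤ Real.circleAverage (fun z => U (z * u)) c R)
    {r : ℝ} (hr : 0 ≤ r) (hrs : r ≤ s) :
    Real.circleAverage U 0 r ≤ Real.circleAverage U 0 s := by
  set v : ℂ → ℝ := fun w => Real.circleAverage (fun u => U (w * u)) 0 1 with hv
  have hpi : 0 < (2 * Real.pi)⁻¹ := by positivity
  have hvcont : Continuous v := by
    simp only [hv, Real.circleAverage, smul_eq_mul]
    apply Continuous.const_mul
    apply intervalIntegral.continuous_parametric_intervalIntegral_of_continuous'
    fun_prop
  have hvnorm : ∀ w, v w = Real.circleAverage U 0 ‖w‖ := by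
    intro w
    rw [Real.circleAverage_eq_integral_add (Complex.arg w), hv]
    simp only [Real.circleAverage]
    congr 2
    ext θ
    congr 1
    conv_lhs => rw [← Complex.norm_mul_exp_arg_mul_I w]
    simp only [circleMap, zero_add, Complex.ofReal_one, one_mul, mul_assoc, ← Complex.exp_add]
    push_cast
    ring_nf
  have hvsub : ∀ c : ℂ, ∀ R : ℝ, 0 < R → ‖c‖ + R ≤ s → v c ≤ Real.circleAverage v c R := by
    intro c R hR hcR
    have h1 : v c ≤ (2 * Real.pi)⁻¹ * ∫ θ in (0:ℝ)..2 * Real.pi, (2 * Real.pi)⁻¹ *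
        ∫ φ in (0:ℝ)..2 * Real.pi, U (circleMap c R φ * circleMap 0 1 θ) := by
      simp only [hv, Real.circleAverage, smul_eq_mul]
      apply mul_le_mul_of_nonneg_left _ hpi.le
      apply intervalIntegral.integral_mono_on (by positivity)
      · exact Continuous.intervalIntegrable (by fun_prop) _ _
      · apply Continuous.intervalIntegrable
        apply Continuous.const_mul
        apply intervalIntegral.continuous_parametric_intervalIntegral_of_continuous'
        fun_prop
      · intro θ _
        have := hsub (circleMap 0 1 θ) (by simp) c R hR hcR
        simpa [Real.circleAverage] using this
    refine h1.trans (le_of_eq ?_)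
    simp only [hv, Real.circleAverage, smul_eq_mul, intervalIntegral.integral_const_mul]
    congr 2
    apply intervalIntegral_intervalIntegral_swap
    have hc : Continuous (Function.uncurry fun θ φ => U (circleMap c R φ * circleMap 0 1 θ)) := by
      fun_prop
    refine (hc.continuousOn.integrableOn_compact
      ((isCompact_uIcc (a := (0 : ℝ)) (b := 2 * Real.pi)).prod
        (isCompact_uIcc (a := (0 : ℝ)) (b := 2 * Real.pi)))).mono_set ?_
    exact Set.prod_mono uIoc_subset_uIcc uIoc_subset_uIcc
  set N : ℝ → ℝ := fun t => v t with hN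
  have hvN : ∀ w, v w = N ‖w‖ := by
    intro w
    simp only [hN]
    rw [hvnorm, hvnorm]
    simp
  have key : ∀ ε : ℝ, 0 < ε → N r + ε * r ^ 2 ≤ N s + ε * s ^ 2 := by
    intro ε hε
    have hNc : Continuous (fun t : ℝ => N t + ε * t ^ 2) := by
      have : Continuous N := hvcont.comp Complex.continuous_ofReal
      fun_prop
    obtain ⟨t₀, ht₀, hmax⟩ := (isCompact_Icc (a := (0:ℝ)) (b := s)).exists_isMaxOn
      ⟨r, hr, hrs⟩ hNc.continuousOn
    rcases eq_or_lt_of_le ht₀.2 with h | hlt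
    · rw [← h]
      exact hmax ⟨hr, hrs⟩
    · exfalso
      set R := s - t₀ with hRdef
      have hR : 0 < R := sub_pos.mpr hlt
      have h1 := hvsub t₀ R hR (by simp [abs_of_nonneg ht₀.1, hRdef])
      have hnorm : ∀ θ : ℝ, ‖circleMap (t₀ : ℂ) R θ‖ ^ 2 =
          t₀ ^ 2 + R ^ 2 + 2 * t₀ * R * Real.cos θ := by
        intro θ
        rw [← Complex.normSq_eq_norm_sq, circleMap, Complex.normSq_apply]
        simp only [Complex.exp_mul_I, ← Complex.ofReal_cos, ← Complex.ofReal_sin, Complex.add_re,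
          Complex.add_im, Complex.mul_re, Complex.mul_im, Complex.ofReal_re, Complex.ofReal_im,
          Complex.I_re, Complex.I_im]
        have := Real.sin_sq_add_cos_sq θ
        ring_nf
        nlinarith [congrArg (fun x => R ^ 2 * x) this]
      have h2 : Real.circleAverage v t₀ R ≤ N t₀ + ε * t₀ ^ 2 - ε * (t₀ ^ 2 + R ^ 2) := by
        have hb : ∀ θ ∈ Icc (0:ℝ) (2 * Real.pi), v (circleMap t₀ R θ) ≤
            N t₀ + ε * t₀ ^ 2 - ε * (t₀ ^ 2 + R ^ 2 + 2 * t₀ * R * Real.cos θ) := by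
          intro θ _
          rw [← hnorm θ, hvN]
          have hmem : ‖circleMap (t₀ : ℂ) R θ‖ ∈ Icc 0 s := by
            refine ⟨norm_nonneg _, ?_⟩
            have := norm_add_le (t₀ : ℂ) (R * Complex.exp (θ * Complex.I))
            rw [norm_mul, Complex.norm_exp_ofReal_mul_I, Complex.norm_real, Complex.norm_real,
              Real.norm_of_nonneg ht₀.1, Real.norm_of_nonneg hR.le] at this
            simp only [circleMap]
            linarith
          have := hmax hmem
          simp only [mem_ofPred_eq] at this
          linarith
        rw [Real.circleAverage, smul_eq_mul]
        have h3 := intervalIntegral.integral_mono_on (μ := volume) (by positivity)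
          (Continuous.intervalIntegrable (by fun_prop) _ _)
          (Continuous.intervalIntegrable (by fun_prop) _ _) hb
        refine (mul_le_mul_of_nonneg_left h3 hpi.le).trans (le_of_eq ?_)
        rw [intervalIntegral.integral_sub, intervalIntegral.integral_const_mul,
          intervalIntegral.integral_add, intervalIntegral.integral_const_mul]
        · simp
          field_simp
        all_goals exact Continuous.intervalIntegrable (by fun_prop) _ _
      have : v t₀ = N t₀ := rfl
      nlinarith [mul_pos hε (pow_pos hR 2)]
  have hfin : N r ≤ N s := by
    apply le_of_forall_pos_le_add
    intro δ hδ
    have := key (δ / (s ^ 2 + 1)) (by positivity)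
    have h2 : δ / (s ^ 2 + 1) * s ^ 2 ≤ δ := by
      rw [div_mul_eq_mul_div, div_le_iff₀ (by positivity)]
      nlinarith
    have h3 : 0 ≤ δ / (s ^ 2 + 1) * r ^ 2 := by positivity
    linarith
  simp only [hN, hvnorm, Complex.norm_real, Real.norm_of_nonneg hr,
    Real.norm_of_nonneg (hr.trans hrs)] at hfin
  exact hfin

/-- The integral means of an analytic function increase with the radius. -/
theorem circleAverage_norm_rpow_mono {g : ℂ → ℂ} (hg : DifferentiableOn ℂ g UD) {p : ℝ}
    (hp : 0 < p) {r s : ℝ} (hr : 0 ≤ r) (hrs : r ≤ s) (hs : s < 1) :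
    Real.circleAverage (fun z => ‖g z‖ ^ p) 0 r ≤ Real.circleAverage (fun z => ‖g z‖ ^ p) 0 s := by
  have hsub : Metric.closedBall (0:ℂ) s ⊆ UD := Metric.closedBall_subset_ball hs
  have hcont : ContinuousOn (fun z => ‖g z‖ ^ p) (Metric.closedBall (0:ℂ) s) :=
    (hg.continuousOn.mono hsub).norm.rpow_const (fun _ _ => Or.inr hp.le)
  obtain ⟨U, hU⟩ := ContinuousMap.exists_restrict_eq
    (Metric.isClosed_closedBall (x := (0:ℂ)) (ε := s))
    ⟨_, continuousOn_iff_continuous_domRestrict.mp hcont⟩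
  have hUeq : ∀ z ∈ Metric.closedBall (0:ℂ) s, U z = ‖g z‖ ^ p := fun z hz => by
    have := DFunLike.congr_fun hU ⟨z, hz⟩
    simpa using this
  have hc : ∀ t : ℝ, 0 ≤ t → t ≤ s →
      Real.circleAverage (fun z => ‖g z‖ ^ p) 0 t = Real.circleAverage U 0 t := by
    intro t ht hts
    apply Real.circleAverage_congr_sphere
    intro z hz
    rw [hUeq]
    rw [abs_of_nonneg ht] at hz
    exact Metric.closedBall_subset_closedBall hts (Metric.sphere_subset_closedBall hz)
  rw [hc r hr hrs, hc s (hr.trans hrs) le_rfl]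
  refine circleAverage_mono_radius U.continuous ?_ hr hrs
  intro u hu c R hR hcR
  have hmem : ∀ z ∈ Metric.closedBall c R, z * u ∈ Metric.closedBall (0:ℂ) s := by
    intro z hz
    rw [mem_closedBall_zero_iff, norm_mul, hu, mul_one]
    rw [mem_closedBall_iff_norm] at hz
    have := norm_add_le (z - c) c
    rw [sub_add_cancel] at this
    linarith
  have han : AnalyticOnNhd ℂ (fun z => g (z * u)) (Metric.closedBall c R) := by
    intro z hz
    have h1 : AnalyticAt ℂ g (z * u) :=
      hg.analyticAt (Metric.isOpen_ball.mem_nhds (hsub (hmem z hz)))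
    exact h1.fun_comp (f := fun z => z * u) (by fun_prop)
  have := norm_rpow_le_circleAverage hR hp han
  rw [hUeq _ (hmem c (Metric.mem_closedBall_self hR.le))]
  refine this.trans (le_of_eq ?_)
  apply Real.circleAverage_congr_sphere
  intro z hz
  rw [abs_of_pos hR] at hz
  exact (hUeq _ (hmem z (Metric.sphere_subset_closedBall hz))).symm

theorem lintegral_ball_polar (F : ℂ → ℝ≥0∞) (c : ℂ) (R : ℝ) :
    ∫⁻ ζ in Metric.ball c R, F ζ =
      ∫⁻ p in Ioo (0 : ℝ) R ×ˢ Ioo (-Real.pi) Real.pi,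
        ENNReal.ofReal p.1 * F (circleMap c p.1 p.2) := by
  have hm : MeasurableSet (Ioo (0 : ℝ) R ×ˢ Ioo (-Real.pi) Real.pi) :=
    measurableSet_Ioo.prod measurableSet_Ioo
  rw [← lintegral_indicator Metric.isOpen_ball.measurableSet,
    ← lintegral_add_left_eq_self _ c, ← Complex.lintegral_comp_polarCoord_symm,
    ← lintegral_indicator hm, ← lintegral_indicator polarCoord.open_target.measurableSet]
  congr 1
  ext p
  have hsymm : c + Complex.polarCoord.symm p = circleMap c p.1 p.2 := by
    rw [Complex.polarCoord_symm_apply, circleMap, Complex.exp_mul_I]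
    simp
  by_cases hp : p ∈ polarCoord.target
  · rw [indicator_of_mem hp, hsymm]
    have hp' : 0 < p.1 ∧ p.2 ∈ Ioo (-Real.pi) Real.pi := hp
    have hmem : circleMap c p.1 p.2 ∈ Metric.ball c R ↔ p.1 < R := by
      rw [mem_ball_iff_norm, circleMap_sub_center, norm_circleMap_zero, abs_of_pos hp'.1]
    by_cases hR : p.1 < R
    · have hmem' : p ∈ Ioo (0 : ℝ) R ×ˢ Ioo (-Real.pi) Real.pi := ⟨⟨hp'.1, hR⟩, hp'.2⟩
      rw [indicator_of_mem (hmem.mpr hR), indicator_of_mem hmem', smul_eq_mul]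
    · rw [indicator_of_notMem (fun h => hR (hmem.mp h)),
        indicator_of_notMem (fun h => hR h.1.2), smul_zero]
  · rw [indicator_of_notMem hp, indicator_of_notMem]
    exact fun h => hp ⟨h.1.1, h.2⟩

theorem lintegral_restrict_dA (F : ℂ → ℝ≥0∞) (s : Set ℂ) :
    ∫⁻ ζ in s, F ζ ∂dA = (ENNReal.ofReal Real.pi)⁻¹ * ∫⁻ ζ in s, F ζ := by
  rw [dA, Measure.restrict_smul, lintegral_smul_measure, smul_eq_mul]

instance : SFinite dA := by unfold dA; infer_instance

theorem measurableSet_UD : MeasurableSet UD := Metric.isOpen_ball.measurableSet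

theorem lintegral_UD_polar (F : ℂ → ℝ≥0∞) :
    ∫⁻ ζ in UD, F ζ ∂dA = (ENNReal.ofReal Real.pi)⁻¹ *
      ∫⁻ p in Ioo (0 : ℝ) 1 ×ˢ Ioo (-Real.pi) Real.pi,
        ENNReal.ofReal p.1 * F (circleMap 0 p.1 p.2) := by
  rw [lintegral_restrict_dA, UD, lintegral_ball_polar]

theorem lintegral_UD_rotate (F : ℂ → ℝ≥0∞) {u : ℂ} (hu : ‖u‖ = 1) :
    ∫⁻ ζ in UD, F (u * ζ) ∂dA = ∫⁻ ζ in UD, F ζ ∂dA := by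
  rw [lintegral_restrict_dA, lintegral_restrict_dA]
  congr 1
  have hu' : u ∈ Submonoid.unitSphere ℂ := by simpa [Submonoid.unitSphere] using hu
  have hmp := (rotation ⟨u, hu'⟩).measurePreserving
  have hpre : (rotation ⟨u, hu'⟩) ⁻¹' UD = UD := by
    ext z; simp [UD]
  have := hmp.setLIntegral_comp_preimage_emb
    (rotation ⟨u, hu'⟩).toHomeomorph.measurableEmbedding F UD
  rw [hpre] at this
  exact this

theorem norm_one_sub_circleMap_ge {ρ θ : ℝ} (h0 : 0 ≤ ρ) (h1 : ρ < 1) (hθ : |θ| ≤ Real.pi) :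
    (1 - ρ + |θ|) / 10 ≤ ‖1 - circleMap 0 ρ θ‖ := by
  have hsq : ‖1 - circleMap 0 ρ θ‖ ^ 2 = (1 - ρ) ^ 2 + 4 * ρ * Real.sin (θ / 2) ^ 2 := by
    rw [← Complex.normSq_eq_norm_sq, circleMap, Complex.normSq_apply]
    simp only [Complex.exp_mul_I, ← Complex.ofReal_cos, ← Complex.ofReal_sin, Complex.add_re,
      Complex.add_im, Complex.mul_re, Complex.mul_im, Complex.ofReal_re, Complex.ofReal_im,
      Complex.I_re, Complex.I_im, Complex.sub_re, Complex.sub_im, Complex.one_re, Complex.one_im,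
      Complex.zero_re, Complex.zero_im]
    have h1 := Real.sin_sq_add_cos_sq θ
    have h2 : Real.cos θ = 1 - 2 * Real.sin (θ / 2) ^ 2 := by
      have h3 := Real.cos_two_mul (θ / 2)
      have h4 := Real.sin_sq_add_cos_sq (θ / 2)
      rw [mul_div_cancel₀ _ two_ne_zero] at h3
      linarith
    have h5 : Real.sin (θ / 2) ^ 2 = (1 - Real.cos θ) / 2 := by linarith
    rw [h5]
    ring_nf
    linear_combination ρ ^ 2 * h1
  have hpi4 : Real.pi ≤ 4 := Real.pi_le_four
  have hpi3 := Real.pi_gt_three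
  have habs : 0 ≤ |θ| := abs_nonneg θ
  refine le_of_sq_le_sq ?_ (norm_nonneg _)
  rw [hsq]
  rcases le_total ρ (1 / 2) with hρ | hρ
  · have : 0 ≤ 4 * ρ * Real.sin (θ / 2) ^ 2 := by positivity
    nlinarith
  · have hsin : |θ| / 4 ≤ |Real.sin (θ / 2)| := by
      have h := Real.mul_abs_le_abs_sin (x := θ / 2) (by
        rw [abs_div, abs_two]; linarith)
      refine le_trans ?_ h
      rw [abs_div, abs_two, div_mul_div_comm, div_le_div_iff₀ (by norm_num) (by positivity)]
      nlinarith
    have h2 : (|θ| / 4) ^ 2 ≤ Real.sin (θ / 2) ^ 2 := by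
      rw [← sq_abs (Real.sin (θ / 2))]
      gcongr
    nlinarith [sq_nonneg (1 - ρ - |θ|), sq_nonneg (Real.sin (θ / 2)), sq_nonneg (1 - ρ)]

/-- Angular integral of the kernel. -/
theorem lintegral_angular_le {x : ℝ} (hx : 1 < x) {ρ : ℝ} (h0 : 0 ≤ ρ) (h1 : ρ < 1) :
    ∫⁻ θ in Ioo (-Real.pi) Real.pi, ENNReal.ofReal (‖1 - circleMap 0 ρ θ‖ ^ (-x)) ≤
      ENNReal.ofReal (2 * 10 ^ x / (x - 1) * (1 - ρ) ^ (1 - x)) := by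
  set δ := 1 - ρ with hδ
  have hδ0 : 0 < δ := by linarith
  have hhalf : ∫⁻ θ in Ioi (0:ℝ), ENNReal.ofReal (10 ^ x * (δ + θ) ^ (-x)) =
      ENNReal.ofReal (10 ^ x / (x - 1) * δ ^ (1 - x)) := by
    have hint : IntegrableOn (fun t : ℝ => t ^ (-x)) (Ioi δ) :=
      integrableOn_Ioi_rpow_of_lt (by linarith) hδ0
    have e : ∫⁻ θ in Ioi (0:ℝ), ENNReal.ofReal (10 ^ x * (δ + θ) ^ (-x)) =
        ∫⁻ t in Ioi δ, ENNReal.ofReal (10 ^ x * t ^ (-x)) := by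
      have := (measurePreserving_add_left volume δ).setLIntegral_comp_preimage_emb
        (measurableEmbedding_addLeft δ) (fun t => ENNReal.ofReal (10 ^ x * t ^ (-x))) (Ioi δ)
      rw [← this]
      congr 2
      ext t; simp
    rw [e, ← ofReal_integral_eq_lintegral_ofReal (hint.const_mul _), integral_const_mul,
      integral_Ioi_rpow_of_lt (by linarith) hδ0]
    · congr 1
      have : x - 1 ≠ 0 := by linarith
      have h2 : -x + 1 ≠ 0 := by intro h; apply this; linarith
      rw [show -x + 1 = 1 - x by ring] at *
      field_simp
      ring
    · filter_upwards [ae_restrict_mem measurableSet_Ioi] with t ht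
      have : 0 < t := hδ0.trans ht
      positivity
  have hneg : ∫⁻ θ in Iio (0:ℝ), ENNReal.ofReal (10 ^ x * (δ + |θ|) ^ (-x)) =
      ∫⁻ θ in Ioi (0:ℝ), ENNReal.ofReal (10 ^ x * (δ + θ) ^ (-x)) := by
    have := (Measure.measurePreserving_neg (volume : Measure ℝ)).setLIntegral_comp_preimage_emb
      (MeasurableEquiv.neg ℝ).measurableEmbedding
      (fun t => ENNReal.ofReal (10 ^ x * (δ + t) ^ (-x))) (Ioi 0)
    rw [← this]
    simp only [neg_preimage, neg_Ioi, neg_zero]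
    refine setLIntegral_congr_fun measurableSet_Iio fun t ht => ?_
    simp only [abs_of_neg (mem_Iio.mp ht)]
  have hpos : ∫⁻ θ in Ioi (0:ℝ), ENNReal.ofReal (10 ^ x * (δ + |θ|) ^ (-x)) =
      ∫⁻ θ in Ioi (0:ℝ), ENNReal.ofReal (10 ^ x * (δ + θ) ^ (-x)) := by
    refine setLIntegral_congr_fun measurableSet_Ioi fun t ht => ?_
    simp only [abs_of_pos (mem_Ioi.mp ht)]
  calc ∫⁻ θ in Ioo (-Real.pi) Real.pi, ENNReal.ofReal (‖1 - circleMap 0 ρ θ‖ ^ (-x))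
      ≤ ∫⁻ θ in Ioo (-Real.pi) Real.pi, ENNReal.ofReal (10 ^ x * (δ + |θ|) ^ (-x)) := by
        refine setLIntegral_mono' measurableSet_Ioo fun θ hθ => ?_
        apply ENNReal.ofReal_le_ofReal
        have hb := norm_one_sub_circleMap_ge h0 h1 (abs_le.mpr ⟨hθ.1.le, hθ.2.le⟩)
        have hp : 0 < δ + |θ| := by positivity
        calc ‖1 - circleMap 0 ρ θ‖ ^ (-x) ≤ ((δ + |θ|) / 10) ^ (-x) :=
              Real.rpow_le_rpow_of_nonpos (by positivity) hb (by linarith)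
          _ = 10 ^ x * (δ + |θ|) ^ (-x) := by
              rw [Real.div_rpow hp.le (by norm_num), Real.rpow_neg (by norm_num : (0:ℝ) ≤ 10),
                div_inv_eq_mul, mul_comm]
    _ ≤ ∫⁻ θ in Iio 0 ∪ Ici 0, ENNReal.ofReal (10 ^ x * (δ + |θ|) ^ (-x)) := by
        apply lintegral_mono_set
        rw [Iio_union_Ici]; exact subset_univ _
    _ ≤ (∫⁻ θ in Iio 0, ENNReal.ofReal (10 ^ x * (δ + |θ|) ^ (-x))) +
          ∫⁻ θ in Ici 0, ENNReal.ofReal (10 ^ x * (δ + |θ|) ^ (-x)) := lintegral_union_le _ _ _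
    _ = ENNReal.ofReal (2 * 10 ^ x / (x - 1) * δ ^ (1 - x)) := by
        rw [hneg, setLIntegral_congr Ioi_ae_eq_Ici.symm, hpos, hhalf, ← ENNReal.ofReal_add]
        · congr 1; ring
        all_goals
          have : 0 < x - 1 := by linarith
          positivity

/-- Every complex number is rotated onto its modulus by a unimodular factor. -/
theorem exists_norm_one_conj_mul_eq_norm (z : ℂ) : ∃ u : ℂ, ‖u‖ = 1 ∧ conj z * u = (‖z‖ : ℂ) := by
  rcases eq_or_ne z 0 with rfl | h
  · exact ⟨1, by simp, by simp⟩
  · refine ⟨z / ‖z‖, by simp [h], ?_⟩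
    rw [← mul_div_assoc, mul_comm, Complex.mul_conj, Complex.normSq_eq_norm_sq]
    have : (‖z‖ : ℂ) ≠ 0 := by simpa using h
    push_cast
    field_simp

/-- Integration of a radial function against a power of the kernel reduces to the radius. -/
theorem lintegral_radial_kernel_le {W : ℝ → ℝ≥0∞} {z : ℂ} (hz : z ∈ UD) {x : ℝ} (hx : 1 < x) :
    ∫⁻ ζ in UD, W ‖ζ‖ * ENNReal.ofReal (‖1 - conj z * ζ‖ ^ (-x)) ∂dA ≤
      (ENNReal.ofReal Real.pi)⁻¹ * ENNReal.ofReal (2 * 10 ^ x / (x - 1)) *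
        ∫⁻ s in Ioo (0 : ℝ) 1, W s * ENNReal.ofReal ((1 - ‖z‖ * s) ^ (1 - x)) := by
  obtain ⟨u, hu, hzu⟩ := exists_norm_one_conj_mul_eq_norm z
  have hz1 : ‖z‖ < 1 := by simpa [UD] using hz
  rw [← lintegral_UD_rotate _ hu, lintegral_UD_polar, mul_assoc]
  gcongr
  rw [Measure.volume_eq_prod, ← Measure.prod_restrict]
  refine (lintegral_prod_le _).trans ?_
  have hc : ENNReal.ofReal (2 * 10 ^ x / (x - 1)) ≠ ∞ := ENNReal.ofReal_ne_top
  rw [← lintegral_const_mul' _ _ hc]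
  refine setLIntegral_mono' measurableSet_Ioo fun s hs => ?_
  have h0 : 0 ≤ ‖z‖ * s := mul_nonneg (norm_nonneg _) hs.1.le
  have h1 : ‖z‖ * s < 1 := by nlinarith [norm_nonneg z, hs.1, hs.2]
  have key : ∀ θ : ℝ, ENNReal.ofReal s * (W ‖u * circleMap 0 s θ‖ *
      ENNReal.ofReal (‖1 - conj z * (u * circleMap 0 s θ)‖ ^ (-x))) =
      ENNReal.ofReal s * W s * ENNReal.ofReal (‖1 - circleMap 0 (‖z‖ * s) θ‖ ^ (-x)) := by
    intro θ
    have e : conj z * (u * circleMap 0 s θ) = circleMap 0 (‖z‖ * s) θ := by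
      rw [← mul_assoc, hzu]; simp [circleMap, mul_assoc]
    rw [e, norm_mul, hu, norm_circleMap_zero, abs_of_pos hs.1, one_mul, mul_assoc]
  simp only [key]
  rw [lintegral_const_mul]
  · calc _ ≤ ENNReal.ofReal s * W s *
          ENNReal.ofReal (2 * 10 ^ x / (x - 1) * (1 - ‖z‖ * s) ^ (1 - x)) := by
          gcongr
          exact lintegral_angular_le hx h0 h1
      _ ≤ 1 * W s * (ENNReal.ofReal (2 * 10 ^ x / (x - 1)) *
            ENNReal.ofReal ((1 - ‖z‖ * s) ^ (1 - x))) := by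
          have hs' : ENNReal.ofReal s ≤ 1 := by
            rw [← ENNReal.ofReal_one]; exact ENNReal.ofReal_le_ofReal hs.2.le
          have hx' : 0 < x - 1 := by linarith
          rw [ENNReal.ofReal_mul (by positivity)]
          gcongr
      _ = _ := by ring
  · fun_prop

theorem lintegral_Iic_one_sub_rpow {s a : ℝ} (hs : s < -1) (ha : a < 1) :
    ∫⁻ t in Iic a, ENNReal.ofReal ((1 - t) ^ s) =
      ENNReal.ofReal ((1 - a) ^ (s + 1) / (-(s + 1))) := by
  have h := (Measure.measurePreserving_sub_left (volume : Measure ℝ)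
    1).setLIntegral_comp_preimage_emb (MeasurableEquiv.subLeft (1:ℝ)).measurableEmbedding
      (fun t => ENNReal.ofReal (t ^ s)) (Ici (1 - a))
  have hpre : (fun x : ℝ => 1 - x) ⁻¹' Ici (1 - a) = Iic a := by ext; simp
  rw [hpre] at h
  have ha' : 0 < 1 - a := by linarith
  rw [h, setLIntegral_congr Ioi_ae_eq_Ici.symm, ← ofReal_integral_eq_lintegral_ofReal
    (integrableOn_Ioi_rpow_of_lt hs ha'), integral_Ioi_rpow_of_lt hs ha']
  · congr 1
    rw [div_neg, neg_div]
  · filter_upwards [ae_restrict_mem measurableSet_Ioi] with t ht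
    have : 0 < t := ha'.trans ht
    positivity

theorem lintegral_Ico_one_sub_rpow {s a : ℝ} (hs : -1 < s) (ha : a < 1) :
    ∫⁻ t in Ico a 1, ENNReal.ofReal ((1 - t) ^ s) =
      ENNReal.ofReal ((1 - a) ^ (s + 1) / (s + 1)) := by
  have h := (Measure.measurePreserving_sub_left (volume : Measure ℝ)
    1).setLIntegral_comp_preimage_emb (MeasurableEquiv.subLeft (1:ℝ)).measurableEmbedding
      (fun t => ENNReal.ofReal (t ^ s)) (Ioc 0 (1 - a))
  have hpre : (fun x : ℝ => 1 - x) ⁻¹' Ioc 0 (1 - a) = Ico a 1 := by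
    ext; simp
  rw [hpre] at h
  have ha' : 0 < 1 - a := by linarith
  have hi := intervalIntegral.intervalIntegrable_rpow' (a := 0) (b := 1 - a) hs
  rw [h, ← ofReal_integral_eq_lintegral_ofReal, ← intervalIntegral.integral_of_le ha'.le,
    integral_rpow (Or.inl hs), Real.zero_rpow (by linarith), sub_zero]
  · exact (intervalIntegrable_iff_integrableOn_Ioc_of_le ha'.le).mp hi
  · filter_upwards [ae_restrict_mem measurableSet_Ioc] with t ht
    have : 0 < t := ht.1
    positivity

/-- Radial integral estimate for functions with two-sided power control. -/
theorem lintegral_power_control_le {V : ℝ → ℝ} {a C A B x : ℝ} (ha0 : 0 ≤ a) (ha1 : a < 1)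
    (hV : 0 ≤ V a) (hC : 0 ≤ C) (hA : -1 < A) (hB : B - x < -1) (hx : 0 ≤ x)
    (h1 : ∀ t, a ≤ t → t < 1 → V t ≤ C * ((1 - t) / (1 - a)) ^ A * V a)
    (h2 : ∀ t, 0 ≤ t → t ≤ a → V t ≤ C * ((1 - t) / (1 - a)) ^ B * V a) :
    ∫⁻ t in Ioo (0 : ℝ) 1, ENNReal.ofReal (V t) * ENNReal.ofReal ((1 - a * t) ^ (-x)) ≤
      ENNReal.ofReal (C * (1 / (A + 1) + 1 / (x - B - 1)) * (V a * (1 - a) ^ (1 - x))) := by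
  have hA' : 0 < A + 1 := by linarith
  have hB' : 0 < x - B - 1 := by linarith
  have ha' : 0 < 1 - a := by linarith
  have hsub : Ioo (0 : ℝ) 1 ⊆ Ioc 0 a ∪ Ico a 1 := by
    intro t ht
    rcases le_total t a with h | h
    · exact Or.inl ⟨ht.1, h⟩
    · exact Or.inr ⟨h, ht.2⟩
  have e1 : ∫⁻ t in Ioc 0 a, ENNReal.ofReal (V t) * ENNReal.ofReal ((1 - a * t) ^ (-x)) ≤
      ENNReal.ofReal (C * (1 / (x - B - 1)) * (V a * (1 - a) ^ (1 - x))) := by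
    calc _ ≤ ∫⁻ t in Ioc 0 a, ENNReal.ofReal (C * V a * (1 - a) ^ (-B)) *
            ENNReal.ofReal ((1 - t) ^ (B - x)) := by
          refine setLIntegral_mono' measurableSet_Ioc fun t ht => ?_
          have ht' : 0 < 1 - t := by linarith [ht.2]
          have hat : 1 - t ≤ 1 - a * t := by nlinarith [ht.1]
          rw [← ENNReal.ofReal_mul' (by have : 0 < 1 - a * t := by linarith
                                        positivity),
            ← ENNReal.ofReal_mul' (by positivity)]
          apply ENNReal.ofReal_le_ofReal
          calc V t * (1 - a * t) ^ (-x)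
              ≤ (C * ((1 - t) / (1 - a)) ^ B * V a) * (1 - t) ^ (-x) := by
                gcongr ?_ * ?_
                · have : 0 < 1 - a * t := by linarith
                  positivity
                · exact h2 t ht.1.le ht.2
                · exact Real.rpow_le_rpow_of_nonpos ht' hat (by linarith)
            _ = _ := by
                have e : (1 - t) ^ (B - x) = (1 - t) ^ B * (1 - t) ^ (-x) := by
                  rw [← Real.rpow_add ht', ← sub_eq_add_neg]
                rw [Real.div_rpow ht'.le ha'.le, Real.rpow_neg ha'.le, e]
                ring
      _ ≤ ENNReal.ofReal (C * V a * (1 - a) ^ (-B)) *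
            ∫⁻ t in Iic a, ENNReal.ofReal ((1 - t) ^ (B - x)) := by
          rw [lintegral_const_mul' _ _ ENNReal.ofReal_ne_top]
          gcongr
          exact fun t ht => ht.2
      _ = _ := by
          rw [lintegral_Iic_one_sub_rpow hB ha1, ← ENNReal.ofReal_mul (by positivity)]
          congr 1
          have e : (1 - a) ^ (1 - x) = (1 - a) ^ (-B) * (1 - a) ^ (B - x + 1) := by
            rw [← Real.rpow_add ha']; congr 1; ring
          rw [e, show -(B - x + 1) = x - B - 1 by ring, div_eq_mul_one_div]
          ac_rfl
  have e2 : ∫⁻ t in Ico a 1, ENNReal.ofReal (V t) * ENNReal.ofReal ((1 - a * t) ^ (-x)) ≤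
      ENNReal.ofReal (C * (1 / (A + 1)) * (V a * (1 - a) ^ (1 - x))) := by
    calc _ ≤ ∫⁻ t in Ico a 1, ENNReal.ofReal (C * V a * (1 - a) ^ (-A - x)) *
            ENNReal.ofReal ((1 - t) ^ A) := by
          refine setLIntegral_mono' measurableSet_Ico fun t ht => ?_
          have ht' : 0 < 1 - t := by linarith [ht.2]
          have hat : 1 - a ≤ 1 - a * t := by nlinarith [ht.1]
          rw [← ENNReal.ofReal_mul' (by have : 0 < 1 - a * t := by linarith
                                        positivity),
            ← ENNReal.ofReal_mul' (by positivity)]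
          apply ENNReal.ofReal_le_ofReal
          calc V t * (1 - a * t) ^ (-x)
              ≤ (C * ((1 - t) / (1 - a)) ^ A * V a) * (1 - a) ^ (-x) := by
                gcongr ?_ * ?_
                · have : 0 < 1 - a * t := by linarith
                  positivity
                · exact h1 t ht.1 ht.2
                · exact Real.rpow_le_rpow_of_nonpos ha' hat (by linarith)
            _ = _ := by
                have e : (1 - a) ^ (-A - x) = (1 - a) ^ (-A) * (1 - a) ^ (-x) := by
                  rw [← Real.rpow_add ha', ← sub_eq_add_neg]
                rw [Real.div_rpow ht'.le ha'.le, e, Real.rpow_neg ha'.le A]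
                ring
      _ = _ := by
          rw [lintegral_const_mul' _ _ ENNReal.ofReal_ne_top,
            lintegral_Ico_one_sub_rpow hA ha1, ← ENNReal.ofReal_mul (by positivity)]
          congr 1
          have e : (1 - a) ^ (1 - x) = (1 - a) ^ (-A - x) * (1 - a) ^ (A + 1) := by
            rw [← Real.rpow_add ha']; congr 1; ring
          rw [e, div_eq_mul_one_div]
          ac_rfl
  calc _ ≤ _ := lintegral_mono_set hsub
    _ ≤ _ := lintegral_union_le _ _ _
    _ ≤ _ := add_le_add e1 e2
    _ = _ := by
        rw [← ENNReal.ofReal_add (by positivity) (by positivity)]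
        congr 1; ring

theorem WhatPos.intervalIntegrable {ω : ℂ → ℝ} (h : WhatPos ω) :
    IntervalIntegrable (fun s : ℝ => ω (s : ℂ)) volume 0 1 := by
  by_contra hn
  have := h 0 le_rfl one_pos
  rw [what, intervalIntegral.integral_undef hn] at this
  exact lt_irrefl _ this

theorem WhatPos.integrableOn_Ioo {ω : ℂ → ℝ} (h : WhatPos ω) :
    IntegrableOn (fun s : ℝ => ω (s : ℂ)) (Ioo 0 1) :=
  ((intervalIntegrable_iff_integrableOn_Ioc_of_le zero_le_one).mp h.intervalIntegrable).mono_set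
    Ioo_subset_Ioc_self

theorem ofReal_what {ω : ℂ → ℝ} (h0 : ∀ z, 0 ≤ ω z) (h : WhatPos ω) {r : ℝ} (hr0 : 0 ≤ r)
    (hr1 : r ≤ 1) :
    ENNReal.ofReal (what ω r) = ∫⁻ s in Ioo r 1, ENNReal.ofReal (ω (s : ℂ)) := by
  rw [what, intervalIntegral.integral_of_le hr1, integral_Ioc_eq_integral_Ioo,
    ofReal_integral_eq_lintegral_ofReal]
  · exact h.integrableOn_Ioo.mono_set (Ioo_subset_Ioo_left hr0)
  · exact Filter.Eventually.of_forall fun s => h0 _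

theorem what_antitoneOn {ω : ℂ → ℝ} (h0 : ∀ z, 0 ≤ ω z) (h : WhatPos ω) :
    AntitoneOn (what ω) (Icc 0 1) := by
  intro r hr t ht hrt
  have : ENNReal.ofReal (what ω t) ≤ ENNReal.ofReal (what ω r) := by
    rw [ofReal_what h0 h ht.1 ht.2, ofReal_what h0 h hr.1 hr.2]
    exact lintegral_mono_set (Ioo_subset_Ioo_left hrt)
  rcases eq_or_lt_of_le hr.2 with rfl | hr1
  · rw [le_antisymm ht.2 hrt]
  · exact (ENNReal.ofReal_le_ofReal_iff (h r hr.1 hr1).le).mp this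

theorem measurable_what_clamp {ω : ℂ → ℝ} (h0 : ∀ z, 0 ≤ ω z) (h : WhatPos ω) :
    Measurable fun s : ℝ => what ω (max 0 (min s 1)) := by
  apply Antitone.measurable
  intro s t hst
  refine what_antitoneOn h0 h ⟨le_max_left _ _, max_le zero_le_one (min_le_right _ _)⟩
    ⟨le_max_left _ _, max_le zero_le_one (min_le_right _ _)⟩ ?_
  gcongr

theorem what_clamp {ω : ℂ → ℝ} {s : ℝ} (h0 : 0 ≤ s) (h1 : s ≤ 1) :
    what ω (max 0 (min s 1)) = what ω s := by
  rw [min_eq_left h1, max_eq_right h0]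

/-- Layer-cake bound for the radial kernel. -/
theorem ofReal_one_sub_mul_rpow_le {a s M : ℝ} (ha0 : 0 ≤ a) (ha1 : a < 1) (hs0 : 0 ≤ s)
    (hs1 : s < 1) (hM : 0 ≤ M) :
    ENNReal.ofReal ((1 - a * s) ^ (-M)) ≤
      1 + ∫⁻ t in Ioo 0 s, ENNReal.ofReal (M * (1 - a * t) ^ (-(M + 1))) := by
  have hpos : ∀ t ∈ Icc 0 s, 0 < 1 - a * t := fun t ht => by nlinarith [ht.1, ht.2]
  have hcont : ContinuousOn (fun t : ℝ => M * (1 - a * t) ^ (-(M + 1))) (Icc 0 s) := by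
    refine continuousOn_const.mul (ContinuousOn.rpow_const (by fun_prop) fun t ht => ?_)
    exact Or.inl (hpos t ht).ne'
  have hint : IntervalIntegrable (fun t : ℝ => M * (1 - a * t) ^ (-(M + 1))) volume 0 s :=
    ContinuousOn.intervalIntegrable (by rwa [uIcc_of_le hs0])
  have hderiv : ∀ t ∈ uIcc 0 s, HasDerivAt (fun t : ℝ => (1 - a * t) ^ (-M))
      (a * (M * (1 - a * t) ^ (-(M + 1)))) t := by
    intro t ht
    rw [uIcc_of_le hs0] at ht
    have h1 : HasDerivAt (fun t : ℝ => 1 - a * t) (-a) t := by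
      simpa using ((hasDerivAt_id t).const_mul a).const_sub 1
    convert h1.rpow_const (p := -M) (Or.inl (hpos t ht).ne') using 1
    rw [show -(M + 1) = -M - 1 by ring]
    ring
  have hF := intervalIntegral.integral_eq_sub_of_hasDerivAt hderiv (hint.const_mul a)
  have hF' : (1 - a * s) ^ (-M) = 1 + a * ∫ t in (0:ℝ)..s, M * (1 - a * t) ^ (-(M + 1)) := by
    rw [← intervalIntegral.integral_const_mul, hF]; simp
  have hnn : 0 ≤ ∫ t in (0:ℝ)..s, M * (1 - a * t) ^ (-(M + 1)) :=
    intervalIntegral.integral_nonneg hs0 fun t ht => by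
      have := hpos t ht
      positivity
  rw [hF']
  calc _ ≤ ENNReal.ofReal (1 + ∫ t in (0:ℝ)..s, M * (1 - a * t) ^ (-(M + 1))) := by
        apply ENNReal.ofReal_le_ofReal
        nlinarith
    _ = _ := by
        rw [ENNReal.ofReal_add zero_le_one hnn, ENNReal.ofReal_one,
          intervalIntegral.integral_of_le hs0, integral_Ioc_eq_integral_Ioo,
          ofReal_integral_eq_lintegral_ofReal]
        · exact ((intervalIntegrable_iff_integrableOn_Ioc_of_le hs0).mp hint).mono_set
            Ioo_subset_Ioc_self
        · filter_upwards [ae_restrict_mem measurableSet_Ioo] with t ht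
          have := hpos t ⟨ht.1.le, ht.2.le⟩
          positivity

theorem lintegral_mul_primitive {ω : ℂ → ℝ} (h0 : ∀ z, 0 ≤ ω z) (h : WhatPos ω)
    {k : ℝ → ℝ≥0∞} (hk : Measurable k) :
    ∫⁻ s in Ioo (0:ℝ) 1, ENNReal.ofReal (ω (s : ℂ)) * ∫⁻ t in Ioo 0 s, k t =
      ∫⁻ t in Ioo (0:ℝ) 1, ENNReal.ofReal (what ω t) * k t := by
  have hω : AEMeasurable (fun s : ℝ => ENNReal.ofReal (ω (s:ℂ))) (volume.restrict (Ioo 0 1)) :=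
    h.integrableOn_Ioo.aestronglyMeasurable.aemeasurable.ennreal_ofReal
  have hS : MeasurableSet {p : ℝ × ℝ | p.2 < p.1} := measurableSet_lt measurable_snd measurable_fst
  calc _ = ∫⁻ s in Ioo (0:ℝ) 1, ∫⁻ t in Ioo (0:ℝ) 1,
          ENNReal.ofReal (ω (s : ℂ)) *
            {p : ℝ × ℝ | p.2 < p.1}.indicator (fun p => k p.2) (s, t) := by
        refine setLIntegral_congr_fun measurableSet_Ioo fun s hs => ?_
        have hm : Measurable fun t : ℝ => {p : ℝ × ℝ | p.2 < p.1}.indicator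
            (fun p => k p.2) (s, t) :=
          ((hk.comp measurable_snd).indicator hS).comp measurable_prodMk_left
        rw [lintegral_const_mul _ hm]
        congr 1
        rw [← lintegral_indicator measurableSet_Ioo, ← lintegral_indicator measurableSet_Ioo]
        congr 1; ext t
        simp only [indicator, mem_Ioo, mem_ofPred_eq]
        have := hs.2
        split_ifs <;> first | rfl | (exfalso; grind)
    _ = ∫⁻ t in Ioo (0:ℝ) 1, ∫⁻ s in Ioo (0:ℝ) 1,
          ENNReal.ofReal (ω (s : ℂ)) *
            {p : ℝ × ℝ | p.2 < p.1}.indicator (fun p => k p.2) (s, t) := by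
        apply lintegral_lintegral_swap
        exact (hω.comp_fst).mul ((hk.comp measurable_snd).indicator hS).aemeasurable
    _ = _ := by
        refine setLIntegral_congr_fun measurableSet_Ioo fun t ht => ?_
        rw [ofReal_what h0 h ht.1.le ht.2.le,
          ← lintegral_mul_const'' _ (hω.mono_set (Ioo_subset_Ioo_left ht.1.le)),
          ← lintegral_indicator measurableSet_Ioo, ← lintegral_indicator measurableSet_Ioo]
        congr 1; ext s
        simp only [indicator, mem_Ioo, mem_ofPred_eq]
        have := ht.1
        split_ifs <;> first | rfl | (exfalso; grind) | simp

theorem one_sub_norm_pos {z : ℂ} (hz : z ∈ UD) : 0 < 1 - ‖z‖ := by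
  have : ‖z‖ < 1 := by simpa [UD] using hz
  linarith

/-- Forelli–Rudin type estimate for weights in `D̂`. -/
theorem lintegral_weight_kernel_le {ω : ℂ → ℝ} (hω : RadialWeight ω) (h : WhatPos ω) {β : ℝ}
    (hβ0 : 0 ≤ β) (hβ : DhatExp ω β) {x : ℝ} (hx : β + 2 < x) :
    ∃ C > (0:ℝ), ∀ z ∈ UD,
      ∫⁻ ζ in UD, ENNReal.ofReal (ω ζ) * ENNReal.ofReal (‖1 - conj z * ζ‖ ^ (-x)) ∂dA ≤
        ENNReal.ofReal (C * (what ω ‖z‖ * (1 - ‖z‖) ^ (1 - x))) := by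
  obtain ⟨C, hC, hexp⟩ := hβ
  set C1 := max C 1
  set K := C + (x - 1) * (C1 * (1 / (0 + 1) + 1 / (x - β - 1))) with hK
  have hx1 : 0 < x - 1 := by linarith
  have hxβ : 0 < x - β - 1 := by linarith
  have hC1 : 0 < C1 := lt_of_lt_of_le one_pos (le_max_right _ _)
  have hKpos : 0 < K := by positivity
  refine ⟨Real.pi⁻¹ * (2 * 10 ^ x / (x - 1)) * K, by positivity, fun z hz => ?_⟩
  set a := ‖z‖
  have ha0 : 0 ≤ a := norm_nonneg z
  have ha' : 0 < 1 - a := one_sub_norm_pos hz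
  have ha1 : a < 1 := by linarith
  have hVa : 0 < what ω a := h a ha0 ha1
  refine (lintegral_congr fun ζ => by rw [hω.2.1 ζ]).trans_le
    ((lintegral_radial_kernel_le (W := fun s : ℝ => ENNReal.ofReal (ω (s : ℂ))) hz
      (by linarith)).trans ?_)
  rw [← ENNReal.ofReal_inv_of_pos Real.pi_pos, ← ENNReal.ofReal_mul (by positivity),
    mul_assoc (Real.pi⁻¹ * (2 * 10 ^ x / (x - 1))),
    ENNReal.ofReal_mul (p := Real.pi⁻¹ * (2 * 10 ^ x / (x - 1))) (by positivity)]
  gcongr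
  set k : ℝ → ℝ≥0∞ := fun t => ENNReal.ofReal ((1 - a * t) ^ (-x))
  have hkm : Measurable k := by fun_prop
  have step1 : ∫⁻ s in Ioo (0 : ℝ) 1, ENNReal.ofReal (ω (s:ℂ)) *
      ENNReal.ofReal ((1 - a * s) ^ (1 - x)) ≤
      ENNReal.ofReal (what ω 0) + ENNReal.ofReal (x - 1) *
        ∫⁻ t in Ioo (0:ℝ) 1, ENNReal.ofReal (what ω t) * k t := by
    rw [ofReal_what hω.1 h le_rfl zero_le_one, ← lintegral_mul_primitive hω.1 h hkm,
      ← lintegral_const_mul' _ _ ENNReal.ofReal_ne_top, ← lintegral_add_left']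
    · refine setLIntegral_mono' measurableSet_Ioo fun s hs => ?_
      calc _ ≤ ENNReal.ofReal (ω (s:ℂ)) *
            (1 + ∫⁻ t in Ioo 0 s, ENNReal.ofReal ((x - 1) * (1 - a * t) ^ (-((x - 1) + 1)))) := by
            gcongr
            rw [show 1 - x = -(x - 1) by ring]
            exact ofReal_one_sub_mul_rpow_le ha0 ha1 hs.1.le hs.2 hx1.le
        _ = _ := by
            simp_rw [ENNReal.ofReal_mul hx1.le, sub_add_cancel]
            rw [lintegral_const_mul' _ _ ENNReal.ofReal_ne_top]
            ring
    · exact h.integrableOn_Ioo.aestronglyMeasurable.aemeasurable.ennreal_ofReal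
  have step2 := lintegral_power_control_le (V := what ω) (A := 0) (B := β) (x := x) (C := C1)
    ha0 ha1 hVa.le hC1.le (by norm_num) (by linarith) (by linarith)
    (fun t hat ht => by
      rw [Real.rpow_zero, mul_one]
      calc what ω t ≤ 1 * what ω a := by
            rw [one_mul]
            exact what_antitoneOn hω.1 h ⟨ha0, ha1.le⟩ ⟨ha0.trans hat, ht.le⟩ hat
        _ ≤ _ := by gcongr; exact le_max_right _ _)
    (fun t ht hta => by
      refine (hexp t a ht hta ha1).trans ?_
      have : 0 ≤ (1 - t) / (1 - a) := div_nonneg (by linarith) ha'.le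
      gcongr
      exact le_max_left _ _)
  have step3 : what ω 0 ≤ C * (what ω a * (1 - a) ^ (1 - x)) := by
    refine (hexp 0 a le_rfl ha0 ha1).trans ?_
    rw [sub_zero, Real.div_rpow zero_le_one ha'.le, Real.one_rpow, one_div,
      ← Real.rpow_neg ha'.le, mul_assoc, mul_comm (what ω a)]
    gcongr C * (?_ * _)
    exact Real.rpow_le_rpow_of_exponent_ge ha' (by linarith) (by linarith)
  calc _ ≤ _ := step1
    _ ≤ ENNReal.ofReal (C * (what ω a * (1 - a) ^ (1 - x))) + ENNReal.ofReal (x - 1) *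
          ENNReal.ofReal
            (C1 * (1 / (0 + 1) + 1 / (x - β - 1)) * (what ω a * (1 - a) ^ (1 - x))) := by
        gcongr
    _ = _ := by
        rw [← ENNReal.ofReal_mul hx1.le, ← ENNReal.ofReal_add (by positivity) (by positivity), hK]
        congr 1; ring

theorem norm_one_sub_conj_mul_sq (z ζ : ℂ) :
    ‖1 - conj z * ζ‖ ^ 2 = ‖z - ζ‖ ^ 2 + (1 - ‖z‖ ^ 2) * (1 - ‖ζ‖ ^ 2) := by
  simp only [← Complex.normSq_eq_norm_sq, Complex.normSq_apply, Complex.sub_re, Complex.sub_im,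
    Complex.mul_re, Complex.mul_im, Complex.conj_re, Complex.conj_im, Complex.one_re,
    Complex.one_im]
  ring

theorem norm_one_sub_conj_mul_comm (z ζ : ℂ) : ‖1 - conj z * ζ‖ = ‖1 - conj ζ * z‖ := by
  rw [← RCLike.norm_conj]; simp [mul_comm]

theorem hyp_comm (z ζ : ℂ) : hyp z ζ = hyp ζ z := by
  have : pd z ζ = pd ζ z := by
    rw [pd, pd, norm_div, norm_div, norm_sub_rev, norm_one_sub_conj_mul_comm]
  rw [hyp, hyp, this]

theorem mem_hDisc_comm {z ζ : ℂ} {r : ℝ} (hz : z ∈ UD) (h : ζ ∈ hDisc z r) : z ∈ hDisc ζ r :=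
  ⟨hz, by rw [hyp_comm]; exact h.2⟩

theorem one_sub_norm_le_kernel {z ζ : ℂ} (hζ : ζ ∈ UD) : 1 - ‖z‖ ≤ ‖1 - conj z * ζ‖ := by
  have h1 : ‖conj z * ζ‖ ≤ ‖z‖ := by
    rw [norm_mul, RCLike.norm_conj]
    exact mul_le_of_le_one_right (norm_nonneg _) (by linarith [one_sub_norm_pos hζ])
  have h2 := norm_sub_norm_le (1 : ℂ) (conj z * ζ)
  rw [norm_one] at h2
  linarith

theorem hyp_lt_iff {z ζ : ℂ} (hz : z ∈ UD) (hζ : ζ ∈ UD) (r : ℝ) :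
    hyp z ζ < r ↔ (‖1 - conj z * ζ‖ + ‖z - ζ‖) ^ 2 <
      Real.exp (2 * r) * ((1 - ‖z‖ ^ 2) * (1 - ‖ζ‖ ^ 2)) := by
  have hz' := one_sub_norm_pos hz
  have hζ' := one_sub_norm_pos hζ
  have hk : 0 < ‖1 - conj z * ζ‖ := hz'.trans_le (one_sub_norm_le_kernel hζ)
  have e := norm_one_sub_conj_mul_sq z ζ
  have hP : 0 < (1 - ‖z‖ ^ 2) * (1 - ‖ζ‖ ^ 2) := by
    apply mul_pos <;> nlinarith [norm_nonneg z, norm_nonneg ζ]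
  have hd : 0 < ‖1 - conj z * ζ‖ - ‖z - ζ‖ := by
    nlinarith [norm_nonneg (z - ζ)]
  have hs : 0 < ‖1 - conj z * ζ‖ + ‖z - ζ‖ := by positivity
  have e1 : (1 + pd z ζ) / (1 - pd z ζ) =
      (‖1 - conj z * ζ‖ + ‖z - ζ‖) / (‖1 - conj z * ζ‖ - ‖z - ζ‖) := by
    have hd' : 1 - ‖z - ζ‖ / ‖1 - conj z * ζ‖ ≠ 0 := by
      rw [← div_self hk.ne', ← sub_div]
      positivity
    rw [pd, norm_div, div_eq_div_iff hd' hd.ne']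
    generalize ‖1 - conj z * ζ‖ = k at *
    field_simp
  have e2 : (1 - ‖z‖ ^ 2) * (1 - ‖ζ‖ ^ 2) =
      (‖1 - conj z * ζ‖ + ‖z - ζ‖) * (‖1 - conj z * ζ‖ - ‖z - ζ‖) := by
    linear_combination -e
  rw [hyp, e1, e2, show (1 / 2 * Real.log ((‖1 - conj z * ζ‖ + ‖z - ζ‖) /
    (‖1 - conj z * ζ‖ - ‖z - ζ‖)) < r) ↔ Real.log ((‖1 - conj z * ζ‖ + ‖z - ζ‖) /
    (‖1 - conj z * ζ‖ - ‖z - ζ‖)) < 2 * r by constructor <;> intro h <;> linarith,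
    Real.log_lt_iff_lt_exp (div_pos hs hd), div_lt_iff₀ hd, sq, mul_left_comm,
    mul_lt_mul_iff_right₀ hs]

theorem kernel_sq_le_of_mem_hDisc {z ζ : ℂ} {r : ℝ} (hz : z ∈ UD) (h : ζ ∈ hDisc z r) :
    ‖1 - conj z * ζ‖ ^ 2 ≤ 4 * Real.exp (2 * r) * ((1 - ‖z‖) * (1 - ‖ζ‖)) := by
  have h1 := (hyp_lt_iff hz h.1 r).mp h.2
  have hz' := one_sub_norm_pos hz
  have hζ' := one_sub_norm_pos h.1
  have h2 : (1 - ‖z‖ ^ 2) * (1 - ‖ζ‖ ^ 2) ≤ (2 * (1 - ‖z‖)) * (2 * (1 - ‖ζ‖)) := by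
    gcongr
    · nlinarith [norm_nonneg ζ]
    · nlinarith [norm_nonneg z]
    · nlinarith [norm_nonneg ζ]
  have h3 : ‖1 - conj z * ζ‖ ^ 2 ≤ (‖1 - conj z * ζ‖ + ‖z - ζ‖) ^ 2 := by
    gcongr
    linarith [norm_nonneg (z - ζ)]
  have h4 := mul_le_mul_of_nonneg_left h2 (Real.exp_pos (2 * r)).le
  linarith

theorem one_sub_norm_le_of_mem_hDisc {z ζ : ℂ} {r : ℝ} (hz : z ∈ UD) (h : ζ ∈ hDisc z r) :
    1 - ‖z‖ ≤ 4 * Real.exp (2 * r) * (1 - ‖ζ‖) := by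
  have h1 := kernel_sq_le_of_mem_hDisc hz h
  have h2 := one_sub_norm_le_kernel (z := z) h.1
  have hz' := one_sub_norm_pos hz
  have : (1 - ‖z‖) * (1 - ‖z‖) ≤ (1 - ‖z‖) * (4 * Real.exp (2 * r) * (1 - ‖ζ‖)) := by nlinarith
  exact le_of_mul_le_mul_left this hz'

theorem kernel_le_of_mem_hDisc {z ζ : ℂ} {r : ℝ} (hz : z ∈ UD) (h : ζ ∈ hDisc z r) :
    ‖1 - conj z * ζ‖ ≤ 4 * Real.exp (2 * r) * (1 - ‖z‖) := by
  have h1 := kernel_sq_le_of_mem_hDisc hz h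
  have h2 : 1 - ‖ζ‖ ≤ ‖1 - conj z * ζ‖ := by
    rw [norm_one_sub_conj_mul_comm]; exact one_sub_norm_le_kernel hz
  have hz' := one_sub_norm_pos hz
  have hζ' := one_sub_norm_pos h.1
  have he := Real.exp_pos (2 * r)
  have : ‖1 - conj z * ζ‖ * ‖1 - conj z * ζ‖ ≤
      ‖1 - conj z * ζ‖ * (4 * Real.exp (2 * r) * (1 - ‖z‖)) := by
    calc _ = ‖1 - conj z * ζ‖ ^ 2 := (sq _).symm
      _ ≤ 4 * Real.exp (2 * r) * ((1 - ‖z‖) * (1 - ‖ζ‖)) := h1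
      _ ≤ 4 * Real.exp (2 * r) * ((1 - ‖z‖) * ‖1 - conj z * ζ‖) := by gcongr
      _ = _ := by ring
  exact le_of_mul_le_mul_left this (hζ'.trans_le h2)

theorem mem_hDisc_of_kernel_sq_lt {z ζ : ℂ} {r : ℝ} (hz : z ∈ UD) (hζ : ζ ∈ UD)
    (h : 4 * ‖1 - conj z * ζ‖ ^ 2 < Real.exp (2 * r) * ((1 - ‖z‖) * (1 - ‖ζ‖))) :
    ζ ∈ hDisc z r := by
  refine ⟨hζ, (hyp_lt_iff hz hζ r).mpr ?_⟩
  have hz' := one_sub_norm_pos hz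
  have hζ' := one_sub_norm_pos hζ
  have e := norm_one_sub_conj_mul_sq z ζ
  have h2 : (1 - ‖z‖) * (1 - ‖ζ‖) ≤ (1 - ‖z‖ ^ 2) * (1 - ‖ζ‖ ^ 2) := by
    gcongr
    · nlinarith [norm_nonneg z]
    · nlinarith [norm_nonneg z]
    · nlinarith [norm_nonneg ζ]
  have h3 := mul_le_mul_of_nonneg_left h2 (Real.exp_pos (2 * r)).le
  have h4 : ‖z - ζ‖ ≤ ‖1 - conj z * ζ‖ := by
    refine le_of_sq_le_sq ?_ (norm_nonneg _)
    have : 0 ≤ (1 - ‖z‖) * (1 - ‖ζ‖) := by positivity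
    linarith
  nlinarith [norm_nonneg (z - ζ)]

theorem ball_half_subset_UD {z : ℂ} (hz : z ∈ UD) : Metric.ball z ((1 - ‖z‖) / 2) ⊆ UD := by
  intro ζ hζ
  have h1 : ‖ζ - z‖ < (1 - ‖z‖) / 2 := by simpa [dist_eq_norm] using hζ
  have h2 := norm_sub_norm_le ζ z
  have := one_sub_norm_pos hz
  simp only [UD, mem_ball_zero_iff]
  linarith

theorem ball_half_subset_hDisc {z : ℂ} (hz : z ∈ UD) {r : ℝ} (hr : 2 ≤ r) :
    Metric.ball z ((1 - ‖z‖) / 2) ⊆ hDisc z r := by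
  intro ζ hζ
  have hζU := ball_half_subset_UD hz hζ
  have h1 : ‖ζ - z‖ < (1 - ‖z‖) / 2 := by simpa [dist_eq_norm] using hζ
  have h2 := norm_sub_norm_le ζ z
  have hz' := one_sub_norm_pos hz
  apply mem_hDisc_of_kernel_sq_lt hz hζU
  have e := norm_one_sub_conj_mul_sq z ζ
  rw [norm_sub_rev z ζ] at e
  have hE : 50 < Real.exp (2 * r) := by
    have h4 : Real.exp 4 ≤ Real.exp (2 * r) := Real.exp_le_exp.mpr (by linarith)
    have h5 : Real.exp 4 = Real.exp 1 ^ 4 := by rw [← Real.exp_nat_mul]; norm_num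
    have h6 : (2.7:ℝ) ^ 4 ≤ Real.exp 1 ^ 4 := by
      gcongr
      linarith [Real.exp_one_gt_d9]
    norm_num at h6
    linarith
  have hk : (1 - ‖z‖) / 2 ≤ 1 - ‖ζ‖ := by linarith
  have a1 : 1 - ‖z‖ ^ 2 ≤ 2 * (1 - ‖z‖) := by nlinarith
  have a2 : 1 - ‖ζ‖ ^ 2 ≤ 2 * (1 - ‖ζ‖) := by nlinarith
  have a3 : (1 - ‖z‖ ^ 2) * (1 - ‖ζ‖ ^ 2) ≤ (2 * (1 - ‖z‖)) * (2 * (1 - ‖ζ‖)) := by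
    gcongr
    nlinarith [norm_nonneg ζ]
  have a4 : ‖ζ - z‖ ^ 2 ≤ (1 - ‖z‖) * (1 - ‖ζ‖) := by
    calc ‖ζ - z‖ ^ 2 = ‖ζ - z‖ * ‖ζ - z‖ := sq _
      _ ≤ ((1 - ‖z‖)) * (1 - ‖ζ‖) := by gcongr <;> linarith
  have a5 : 0 < (1 - ‖z‖) * (1 - ‖ζ‖) := by
    apply mul_pos <;> linarith
  nlinarith

theorem measurableSet_hDisc (z : ℂ) (r : ℝ) : MeasurableSet (hDisc z r) := by
  have : Measurable (hyp z) := by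
    unfold hyp pd
    fun_prop
  exact measurableSet_UD.inter (this measurableSet_Iio)

theorem hDisc_subset_UD (z : ℂ) (r : ℝ) : hDisc z r ⊆ UD := fun _ h => h.1

theorem Dhat.exists_exp {ν : ℂ → ℝ} (hν : RadialWeight ν) (h : WhatPos ν) (hD : Dhat ν) :
    ∃ β > (0:ℝ), DhatExp ν β := by
  obtain ⟨C, hC, hD⟩ := hD
  have hC0 : 0 < C := by linarith
  have key : ∀ n : ℕ, ∀ r t : ℝ, 0 ≤ r → r ≤ t → t < 1 → 1 - r ≤ 2 ^ n * (1 - t) →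
      what ν r ≤ C ^ n * what ν t := by
    intro n
    induction n with
    | zero =>
      intro r t _ h1 _ h3
      have : r = t := by
        rw [pow_zero, one_mul] at h3; linarith
      simp [this]
    | succ n ih =>
      intro r t h0 h1 h2 h3
      have hw := hD r h0 (by linarith)
      rcases le_total ((1 + r) / 2) t with hr | hr
      · have := ih _ t (by linarith) hr h2 (by rw [pow_succ] at h3; linarith)
        calc _ ≤ _ := hw
          _ ≤ C * (C ^ n * what ν t) := by gcongr
          _ = _ := by ring
      · have hmono := what_antitoneOn hν.1 h (a := t) (b := (1 + r) / 2) ⟨h0.trans h1, h2.le⟩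
          ⟨by linarith, by linarith⟩ hr
        have hpos := h t (h0.trans h1) h2
        calc _ ≤ _ := hw
          _ ≤ C * what ν t := by gcongr
          _ ≤ C ^ (n + 1) * what ν t := by
            gcongr
            exact le_self_pow₀ hC.le (by simp)
  refine ⟨Real.logb 2 C, Real.logb_pos (by norm_num) hC, C, hC0, fun r t h0 h1 h2 => ?_⟩
  have ht : 0 < 1 - t := by linarith
  set X := (1 - r) / (1 - t)
  have hX : 1 ≤ X := by rw [one_le_div ht]; linarith
  have hX0 : 0 < X := by linarith
  set n := ⌈Real.logb 2 X⌉₊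
  have hn1 : Real.logb 2 X ≤ n := Nat.le_ceil _
  have hn2 : (n : ℝ) < Real.logb 2 X + 1 :=
    Nat.ceil_lt_add_one (Real.logb_nonneg (by norm_num) hX)
  have hXn : X ≤ 2 ^ n := by
    rw [Real.logb_le_iff_le_rpow (by norm_num) hX0, Real.rpow_natCast] at hn1
    exact hn1
  have hCn : C ^ n ≤ C * X ^ Real.logb 2 C := by
    calc C ^ n = C ^ (n : ℝ) := (Real.rpow_natCast _ _).symm
      _ ≤ C ^ (1 + Real.logb 2 X) := Real.rpow_le_rpow_of_exponent_le hC.le (by linarith)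
      _ = C * X ^ Real.logb 2 C := by
          rw [Real.rpow_add hC0, Real.rpow_one]
          congr 1
          conv_lhs => rw [← Real.rpow_logb (b := 2) (by norm_num) (by norm_num) hC0]
          rw [← Real.rpow_mul (by norm_num), mul_comm, Real.rpow_mul (by norm_num),
            Real.rpow_logb (by norm_num) (by norm_num) hX0]
  calc what ν r ≤ C ^ n * what ν t := key n r t h0 h1 h2 ((div_le_iff₀ ht).mp hXn)
    _ ≤ _ := by
      have := h t (h0.trans h1) h2
      gcongr

theorem Dcheck.exists_lintegral_ge {ν : ℂ → ℝ} (hν : RadialWeight ν) (h : WhatPos ν)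
    (hD : Dcheck ν) : ∃ K > (1:ℝ), ∃ c > (0:ℝ), ∀ ρ : ℝ, 0 ≤ ρ → ρ < 1 →
      ENNReal.ofReal (c * what ν ρ) ≤
        ∫⁻ s in Ioc ρ (1 - (1 - ρ) / K), ENNReal.ofReal (ν (s : ℂ)) := by
  obtain ⟨K, hK, C, hC, hD⟩ := hD
  have hC0 : 0 < C := by linarith
  refine ⟨K, hK, 1 - C⁻¹, sub_pos.mpr (inv_lt_one_of_one_lt₀ hC), fun ρ h0 h1 => ?_⟩
  set t := 1 - (1 - ρ) / K with ht
  have hq : (1 - ρ) / K ≤ 1 - ρ := div_le_self (by linarith) hK.le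
  have hq0 : 0 < (1 - ρ) / K := div_pos (by linarith) (by linarith)
  have ht0 : 0 ≤ t := by linarith
  have ht1 : t < 1 := by linarith
  have hle : what ν t ≤ C⁻¹ * what ν ρ := by
    rw [inv_mul_eq_div, le_div_iff₀' hC0]; exact hD ρ h0 h1
  have hsub : Ioo ρ 1 ⊆ Ioc ρ t ∪ Ioo t 1 := by
    intro s hs
    rcases le_or_gt s t with h | h
    · exact Or.inl ⟨hs.1, h⟩
    · exact Or.inr ⟨h, hs.2⟩
  calc _ ≤ ENNReal.ofReal (what ν ρ - what ν t) := by
        apply ENNReal.ofReal_le_ofReal; linarith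
    _ = ENNReal.ofReal (what ν ρ) - ENNReal.ofReal (what ν t) :=
        ENNReal.ofReal_sub _ (h t ht0 ht1).le
    _ ≤ _ := by
        rw [tsub_le_iff_right, ofReal_what hν.1 h h0 h1.le, ofReal_what hν.1 h ht0 ht1.le]
        exact (lintegral_mono_set hsub).trans (lintegral_union_le _ _ _)

theorem ofReal_setIntegral_hDisc {F : ℂ → ℝ} (hF0 : ∀ ζ, 0 ≤ F ζ) (hF : IntegrableOn F UD dA)
    (z : ℂ) (r : ℝ) :
    ENNReal.ofReal (∫ ζ in hDisc z r, F ζ ∂dA) = ∫⁻ ζ in hDisc z r, ENNReal.ofReal (F ζ) ∂dA :=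
  ofReal_integral_eq_lintegral_ofReal (hF.mono_set (hDisc_subset_UD z r))
    (Filter.Eventually.of_forall hF0)

theorem exists_nuD_le {ν : ℂ → ℝ} (hν : RadialWeight ν) (h : WhatPos ν) (hD : Dhat ν) (r : ℝ) :
    ∃ C > (0:ℝ), ∀ z ∈ UD, nuD ν z r ≤ C * (what ν ‖z‖ * (1 - ‖z‖)) := by
  obtain ⟨β, hβ, hexp⟩ := hD.exists_exp hν h
  set x := β + 3 with hx
  obtain ⟨C, hC, hk⟩ := lintegral_weight_kernel_le hν h hβ.le hexp (x := x) (by linarith)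
  set κ := 4 * Real.exp (2 * r)
  have hκ : 0 < κ := by positivity
  refine ⟨κ ^ x * C, by positivity, fun z hz => ?_⟩
  have hz' := one_sub_norm_pos hz
  have hw : 0 < what ν ‖z‖ := h _ (norm_nonneg _) (by linarith)
  rw [← ENNReal.ofReal_le_ofReal_iff (by positivity), nuD,
    ofReal_setIntegral_hDisc hν.1 hν.2.2]
  calc _ ≤ ∫⁻ ζ in hDisc z r, ENNReal.ofReal ((κ * (1 - ‖z‖)) ^ x) *
          (ENNReal.ofReal (ν ζ) * ENNReal.ofReal (‖1 - conj z * ζ‖ ^ (-x))) ∂dA := by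
        refine setLIntegral_mono' (measurableSet_hDisc z r) fun ζ hζ => ?_
        have hkp : 0 < ‖1 - conj z * ζ‖ := hz'.trans_le (one_sub_norm_le_kernel hζ.1)
        rw [mul_left_comm, ← ENNReal.ofReal_mul (by positivity)]
        refine le_mul_of_one_le_right zero_le ?_
        rw [ENNReal.one_le_ofReal, Real.rpow_neg hkp.le, ← div_eq_mul_inv,
          one_le_div (by positivity)]
        exact Real.rpow_le_rpow hkp.le (kernel_le_of_mem_hDisc hz hζ) (by linarith)
    _ ≤ ENNReal.ofReal ((κ * (1 - ‖z‖)) ^ x) *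
          ∫⁻ ζ in UD, ENNReal.ofReal (ν ζ) * ENNReal.ofReal (‖1 - conj z * ζ‖ ^ (-x)) ∂dA := by
        rw [lintegral_const_mul' _ _ ENNReal.ofReal_ne_top]
        gcongr
        exact hDisc_subset_UD z r
    _ ≤ ENNReal.ofReal ((κ * (1 - ‖z‖)) ^ x) *
          ENNReal.ofReal (C * (what ν ‖z‖ * (1 - ‖z‖) ^ (1 - x))) := by
        gcongr
        exact hk z hz
    _ = _ := by
        rw [← ENNReal.ofReal_mul (by positivity)]
        congr 1
        rw [Real.mul_rpow hκ.le hz'.le]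
        have : (1 - ‖z‖) ^ x * (1 - ‖z‖) ^ (1 - x) = 1 - ‖z‖ := by
          rw [← Real.rpow_add hz', add_sub_cancel, Real.rpow_one]
        linear_combination (κ ^ x * C * what ν ‖z‖) * this

theorem exists_le_nuD {ν : ℂ → ℝ} (hν : RadialWeight ν) (h : WhatPos ν) (hD : Dclass ν) :
    ∃ r0 > (0:ℝ), ∃ c > (0:ℝ), ∀ r, r0 ≤ r → ∀ z ∈ UD,
      c * (what ν ‖z‖ * (1 - ‖z‖)) ≤ nuD ν z r := by
  obtain ⟨⟨C, hC, hhat⟩, hcheck⟩ := hD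
  obtain ⟨K, hK, c, hc, hbox⟩ := hcheck.exists_lintegral_ge hν h
  have hC0 : 0 < C := by linarith
  have hK0 : 0 < K := by linarith
  refine ⟨72 * K, by positivity, Real.pi⁻¹ * c / C, by positivity, fun r hr z hz => ?_⟩
  obtain ⟨u, hu, hzu⟩ := exists_norm_one_conj_mul_eq_norm z
  have hz' := one_sub_norm_pos hz
  have hz0 := norm_nonneg z
  set δ := 1 - ‖z‖ with hδ
  set ρ := (1 + ‖z‖) / 2 with hρ
  have hρ1 : ρ < 1 := by linarith
  have hρ0 : 0 ≤ ρ := by linarith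
  set t := 1 - (1 - ρ) / K with ht
  have hq0 : 0 < (1 - ρ) / K := div_pos (by linarith) hK0
  have hmem : ∀ s ∈ Ioc ρ t, ∀ θ ∈ Ioo (-δ) δ, u * circleMap 0 s θ ∈ hDisc z r := by
    intro s hs θ hθ
    have hs0 : 0 ≤ s := hρ0.trans hs.1.le
    have hs1 : s < 1 := by linarith [hs.2]
    have hn : ‖u * circleMap 0 s θ‖ = s := by
      rw [norm_mul, hu, norm_circleMap_zero, abs_of_nonneg hs0, one_mul]
    apply mem_hDisc_of_kernel_sq_lt hz
    · simp only [UD, mem_ball_zero_iff, hn, hs1]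
    rw [hn]
    have e : conj z * (u * circleMap 0 s θ) = circleMap 0 (‖z‖ * s) θ := by
      rw [← mul_assoc, hzu]; simp [circleMap, mul_assoc]
    have hb : ‖1 - conj z * (u * circleMap 0 s θ)‖ ≤ 3 * δ := by
      rw [e, circleMap, zero_add]
      have e2 : 1 - ((‖z‖ * s : ℝ) : ℂ) * Complex.exp (θ * Complex.I) =
          ((1 - ‖z‖ * s : ℝ) : ℂ) -
            ((‖z‖ * s : ℝ) : ℂ) * (Complex.exp (Complex.I * θ) - 1) := by
        push_cast; rw [mul_comm (θ : ℂ)]; ring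
      rw [e2]
      refine (norm_sub_le _ _).trans ?_
      have h3 := Real.norm_exp_I_mul_ofReal_sub_one_le (x := θ)
      have h4 : |θ| ≤ δ := (abs_lt.mpr hθ).le
      have h5 : 0 ≤ ‖z‖ * s := by positivity
      have h6 : ‖z‖ * s ≤ 1 := by nlinarith
      rw [norm_mul, Complex.norm_real, Complex.norm_real, Real.norm_of_nonneg h5,
        Real.norm_of_nonneg (by linarith)]
      rw [Real.norm_eq_abs] at h3
      have h7 : ‖z‖ * s * ‖Complex.exp (Complex.I * θ) - 1‖ ≤ 1 * δ := by
        gcongr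
        linarith
      nlinarith [hs.1]
    have hs2 : δ / (2 * K) ≤ 1 - s := by
      have : (1 - ρ) / K = δ / (2 * K) := by
        rw [hρ, hδ]; field_simp; ring
      linarith [hs.2]
    have hE : 72 * K < Real.exp (2 * r) := by
      have := Real.add_one_le_exp (2 * r)
      have : 0 < 72 * K := by positivity
      linarith
    calc 4 * ‖1 - conj z * (u * circleMap 0 s θ)‖ ^ 2 ≤ 4 * (3 * δ) ^ 2 := by gcongr
      _ = 72 * K * (δ * (δ / (2 * K))) := by field_simp; ring
      _ < Real.exp (2 * r) * (δ * (δ / (2 * K))) := by gcongr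
      _ ≤ _ := by gcongr
  have hw : 0 < what ν ‖z‖ := h _ hz0 (by linarith)
  have hnuD : 0 ≤ nuD ν z r := integral_nonneg fun ζ => hν.1 ζ
  rw [← ENNReal.ofReal_le_ofReal_iff hnuD, nuD, ofReal_setIntegral_hDisc hν.1 hν.2.2]
  have hνm : AEMeasurable (fun s : ℝ => ENNReal.ofReal (ν (s:ℂ))) (volume.restrict (Ioc ρ t)) :=
    (h.integrableOn_Ioo.aestronglyMeasurable.aemeasurable.ennreal_ofReal).mono_set
      (show Ioc ρ t ⊆ Ioo 0 1 from fun s hs => ⟨hρ0.trans_lt hs.1, by linarith [hs.2]⟩)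
  have hpi := Real.pi_gt_three
  have hsub : Ioc ρ t ×ˢ Ioo (-δ) δ ⊆ Ioo (0:ℝ) 1 ×ˢ Ioo (-Real.pi) Real.pi := by
    apply prod_mono
    · exact fun s hs => ⟨hρ0.trans_lt hs.1, by linarith [hs.2]⟩
    · exact Ioo_subset_Ioo (by linarith) (by linarith)
  refine ge_iff_le.mp ?_
  calc ∫⁻ ζ in hDisc z r, ENNReal.ofReal (ν ζ) ∂dA
      = ∫⁻ ζ in UD, (hDisc z r).indicator (fun ζ => ENNReal.ofReal (ν ζ)) ζ ∂dA := by
        rw [setLIntegral_indicator (measurableSet_hDisc z r),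
          inter_eq_left.mpr (hDisc_subset_UD z r)]
    _ = ∫⁻ ζ in UD, (hDisc z r).indicator (fun ζ => ENNReal.ofReal (ν ζ)) (u * ζ) ∂dA :=
        (lintegral_UD_rotate _ hu).symm
    _ ≥ (ENNReal.ofReal Real.pi)⁻¹ * ∫⁻ p in Ioc ρ t ×ˢ Ioo (-δ) δ,
          ENNReal.ofReal 2⁻¹ * (ENNReal.ofReal (ν (p.1 : ℂ)) * 1) := by
        rw [lintegral_UD_polar]
        refine mul_le_mul_right (le_trans ?_ (lintegral_mono_set hsub)) _
        refine setLIntegral_mono' (measurableSet_Ioc.prod measurableSet_Ioo) fun p hp => ?_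
        have hp1 : ρ < p.1 := hp.1.1
        rw [indicator_of_mem (hmem p.1 hp.1 p.2 hp.2), mul_one, hν.2.1 (u * _), norm_mul, hu,
          norm_circleMap_zero, abs_of_nonneg (hρ0.trans hp1.le), one_mul]
        gcongr
        linarith
    _ = (ENNReal.ofReal Real.pi)⁻¹ * (ENNReal.ofReal 2⁻¹ *
          ((∫⁻ s in Ioc ρ t, ENNReal.ofReal (ν (s : ℂ))) * ENNReal.ofReal (2 * δ))) := by
        rw [lintegral_const_mul' _ _ ENNReal.ofReal_ne_top, Measure.volume_eq_prod,
          ← Measure.prod_restrict, lintegral_prod_mul hνm aemeasurable_const]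
        simp [two_mul]
    _ ≥ (ENNReal.ofReal Real.pi)⁻¹ * (ENNReal.ofReal 2⁻¹ *
          (ENNReal.ofReal (c * what ν ρ) * ENNReal.ofReal (2 * δ))) := by
        gcongr
        exact hbox ρ hρ0 hρ1
    _ ≥ _ := by
        have := hhat ‖z‖ hz0 (by linarith)
        have hwρ := h ρ hρ0 hρ1
        rw [← ENNReal.ofReal_inv_of_pos Real.pi_pos, ← ENNReal.ofReal_mul (by positivity),
          ← ENNReal.ofReal_mul (by positivity), ← ENNReal.ofReal_mul (by positivity)]
        apply ENNReal.ofReal_le_ofReal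
        calc Real.pi⁻¹ * c / C * (what ν ‖z‖ * δ)
            ≤ Real.pi⁻¹ * c / C * (C * what ν ρ * δ) := by gcongr
          _ = _ := by field_simp

theorem lintegral_circleMap_eq {G : ℂ → ℝ} {c : ℂ} {R : ℝ} (hG0 : ∀ ζ, 0 ≤ G ζ)
    (hG : ContinuousOn G (Metric.sphere c |R|)) :
    ∫⁻ θ in Ioo (-Real.pi) Real.pi, ENNReal.ofReal (G (circleMap c R θ)) =
      ENNReal.ofReal (2 * Real.pi * Real.circleAverage G c R) := by
  have hcont : Continuous fun θ => G (circleMap c R θ) :=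
    hG.comp_continuous (continuous_circleMap c R) (circleMap_mem_sphere' c R)
  have hle : -Real.pi ≤ Real.pi := by linarith [Real.pi_pos]
  have hper : Function.Periodic (fun θ => G (circleMap c R θ)) (2 * Real.pi) := fun θ => by
    simp only [periodic_circleMap c R θ]
  have e := hper.intervalIntegral_add_eq 0 (-Real.pi)
  rw [zero_add, show -Real.pi + 2 * Real.pi = Real.pi by ring] at e
  rw [Real.circleAverage_def, e, smul_eq_mul, mul_inv_cancel_left₀ (by positivity),
    intervalIntegral.integral_of_le hle, integral_Ioc_eq_integral_Ioo,
    ofReal_integral_eq_lintegral_ofReal]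
  · exact (hcont.integrableOn_Icc).mono_set Ioo_subset_Icc_self
  · exact Filter.Eventually.of_forall fun θ => hG0 _

/-- Polar coordinates with a radial factor. -/
theorem lintegral_ball_radial_mul {G : ℂ → ℝ} {c : ℂ} {R : ℝ} {W : ℝ → ℝ≥0∞}
    (hW : AEMeasurable W (volume.restrict (Ioo 0 R))) (hG0 : ∀ ζ, 0 ≤ G ζ)
    (hG : ContinuousOn G (Metric.ball c R)) :
    ∫⁻ ζ in Metric.ball c R, W ‖ζ - c‖ * ENNReal.ofReal (G ζ) =
      ∫⁻ ρ in Ioo 0 R, W ρ * ENNReal.ofReal (2 * Real.pi * ρ * Real.circleAverage G c ρ) := by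
  have hm : MeasurableSet (Ioo (0 : ℝ) R ×ˢ Ioo (-Real.pi) Real.pi) :=
    measurableSet_Ioo.prod measurableSet_Ioo
  have hmaps : MapsTo (fun p : ℝ × ℝ => circleMap c p.1 p.2)
      (Ioo (0 : ℝ) R ×ˢ Ioo (-Real.pi) Real.pi) (Metric.ball c R) := fun p hp => by
    rw [mem_ball_iff_norm, circleMap_sub_center, norm_circleMap_zero, abs_of_pos hp.1.1]
    exact hp.1.2
  have hcm : Continuous fun p : ℝ × ℝ => circleMap c p.1 p.2 := by
    unfold circleMap; fun_prop
  have hGm : AEMeasurable (fun p : ℝ × ℝ => ENNReal.ofReal (G (circleMap c p.1 p.2)))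
      ((volume.restrict (Ioo (0 : ℝ) R)).prod (volume.restrict (Ioo (-Real.pi) Real.pi))) := by
    rw [Measure.prod_restrict]
    exact ((hG.comp hcm.continuousOn hmaps).aemeasurable hm).ennreal_ofReal
  rw [lintegral_ball_polar, Measure.volume_eq_prod, ← Measure.prod_restrict]
  have e : ∀ p : ℝ × ℝ, W ‖circleMap c p.1 p.2 - c‖ = W |p.1| := fun p => by
    rw [circleMap_sub_center, norm_circleMap_zero]
  simp only [e]
  have hWabs : AEMeasurable (fun s => W |s|) (volume.restrict (Ioo 0 R)) := by
    refine hW.congr ?_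
    filter_upwards [ae_restrict_mem measurableSet_Ioo] with s hs
    rw [abs_of_pos hs.1]
  rw [lintegral_prod]
  · refine setLIntegral_congr_fun measurableSet_Ioo fun s hs => ?_
    simp only
    have hsph : Metric.sphere c |s| ⊆ Metric.ball c R := by
      rw [abs_of_pos hs.1]
      exact fun ζ hζ => by
        rw [Metric.mem_ball, Metric.mem_sphere.mp hζ]; exact hs.2
    have hcs : Continuous fun θ => G (circleMap c s θ) :=
      (hG.mono hsph).comp_continuous (continuous_circleMap c s) (circleMap_mem_sphere' c s)
    have hms : Measurable fun θ => ENNReal.ofReal (G (circleMap c s θ)) :=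
      hcs.measurable.ennreal_ofReal
    rw [lintegral_const_mul _ (hms.const_mul _), lintegral_const_mul _ hms,
      lintegral_circleMap_eq hG0 (hG.mono hsph), abs_of_pos hs.1, mul_left_comm,
      ← ENNReal.ofReal_mul hs.1.le]
    congr 2; ring
  · exact (measurable_fst.ennreal_ofReal.aemeasurable).mul
      ((hWabs.comp_fst).mul hGm)

/-- Area sub-mean value property. -/
theorem norm_rpow_le_lintegral_ball {g : ℂ → ℂ} (hg : DifferentiableOn ℂ g UD) {p : ℝ}
    (hp : 0 < p) {z : ℂ} (hz : z ∈ UD) :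
    ENNReal.ofReal (‖g z‖ ^ p) ≤ ENNReal.ofReal (4 * (1 - ‖z‖) ^ (-2 : ℝ)) *
      ∫⁻ ζ in Metric.ball z ((1 - ‖z‖) / 2), ENNReal.ofReal (‖g ζ‖ ^ p) ∂dA := by
  have hz' := one_sub_norm_pos hz
  set R := (1 - ‖z‖) / 2 with hR
  have hR0 : 0 < R := by positivity
  have hsub := ball_half_subset_UD hz
  have hcont : ContinuousOn (fun ζ => ‖g ζ‖ ^ p) (Metric.ball z R) :=
    ((hg.continuousOn.mono hsub).norm).rpow_const fun _ _ => Or.inr hp.le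
  have hpolar := lintegral_ball_radial_mul (W := fun _ => 1) (c := z) (R := R)
    (G := fun ζ => ‖g ζ‖ ^ p) aemeasurable_const (fun ζ => by positivity) hcont
  simp only [one_mul] at hpolar
  rw [lintegral_restrict_dA, hpolar]
  have hlow : ENNReal.ofReal (Real.pi * R ^ 2 * ‖g z‖ ^ p) ≤ ∫⁻ ρ in Ioo 0 R,
      ENNReal.ofReal (2 * Real.pi * ρ * Real.circleAverage (fun ζ => ‖g ζ‖ ^ p) z ρ) := by
    have hi : ENNReal.ofReal (Real.pi * R ^ 2 * ‖g z‖ ^ p) =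
        ∫⁻ ρ in Ioo 0 R, ENNReal.ofReal (2 * Real.pi * ρ * ‖g z‖ ^ p) := by
      rw [← ofReal_integral_eq_lintegral_ofReal, ← integral_Ioc_eq_integral_Ioo,
        ← intervalIntegral.integral_of_le hR0.le]
      · congr 1
        rw [intervalIntegral.integral_mul_const, intervalIntegral.integral_const_mul, integral_id]
        ring
      · exact ((by fun_prop : Continuous fun ρ : ℝ => 2 * Real.pi * ρ * ‖g z‖ ^ p).integrableOn_Icc
          ).mono_set
          Ioo_subset_Icc_self
      · filter_upwards [ae_restrict_mem measurableSet_Ioo] with s hs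
        have := hs.1
        have := Real.pi_pos
        positivity
    rw [hi]
    refine setLIntegral_mono' measurableSet_Ioo fun ρ hρ => ?_
    apply ENNReal.ofReal_le_ofReal
    have : 0 ≤ 2 * Real.pi * ρ := mul_nonneg (by positivity) hρ.1.le
    gcongr
    refine norm_rpow_le_circleAverage hρ.1 hp ?_
    have hUD : AnalyticOnNhd ℂ g UD := hg.analyticOnNhd Metric.isOpen_ball
    exact hUD.mono ((Metric.closedBall_subset_ball hρ.2).trans hsub)
  have hg0 : 0 ≤ ‖g z‖ ^ p := by positivity
  have hpi := Real.pi_pos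
  calc ENNReal.ofReal (‖g z‖ ^ p) = ENNReal.ofReal (4 * (1 - ‖z‖) ^ (-2 : ℝ)) *
        ((ENNReal.ofReal Real.pi)⁻¹ * ENNReal.ofReal (Real.pi * R ^ 2 * ‖g z‖ ^ p)) := by
        rw [← ENNReal.ofReal_inv_of_pos hpi, ← ENNReal.ofReal_mul (by positivity),
          ← ENNReal.ofReal_mul (by positivity)]
        congr 1
        rw [Real.rpow_neg hz'.le, Real.rpow_two, hR]
        field_simp
        ring
    _ ≤ _ := by gcongr

/-- Comparison of a weighted integral with the smoothed weight `ω̂(ζ)/(1-|ζ|)`. -/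
theorem exists_lintegral_what_div_le {ω : ℂ → ℝ} (hω : RadialWeight ω) (h : WhatPos ω)
    (hD : Dcheck ω) {p : ℝ} (hp : 0 < p) :
    ∃ C > (0:ℝ), ∀ g : ℂ → ℂ, DifferentiableOn ℂ g UD →
      ∫⁻ ζ in UD, ENNReal.ofReal (what ω ‖ζ‖ / (1 - ‖ζ‖)) * ENNReal.ofReal (‖g ζ‖ ^ p) ∂dA ≤
        ENNReal.ofReal C *
          ∫⁻ ζ in UD, ENNReal.ofReal (ω ζ) * ENNReal.ofReal (‖g ζ‖ ^ p) ∂dA := by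
  obtain ⟨K, hK, c, hc, hbox⟩ := hD.exists_lintegral_ge hω h
  have hK0 : 0 < K := by linarith
  refine ⟨c⁻¹ * K, by positivity, fun g hg => ?_⟩
  have hcont : ContinuousOn (fun ζ => ‖g ζ‖ ^ p) (Metric.ball 0 1) :=
    (hg.continuousOn.norm).rpow_const fun _ _ => Or.inr hp.le
  set φ : ℝ → ℝ≥0∞ := fun s =>
    ENNReal.ofReal (2 * Real.pi * s * Real.circleAverage (fun ζ => ‖g ζ‖ ^ p) 0 s) with hφ
  have hφmono : MonotoneOn φ (Ioo 0 1) := by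
    intro s hs t ht hst
    apply ENNReal.ofReal_le_ofReal
    have h1 := circleAverage_norm_rpow_mono hg hp hs.1.le hst ht.2
    have h2 : 0 ≤ Real.circleAverage (fun ζ => ‖g ζ‖ ^ p) 0 s :=
      Real.circleAverage_nonneg_of_nonneg fun ζ _ => by positivity
    have := Real.pi_pos
    have := hs.1
    have := ht.1
    gcongr
  have hφm : AEMeasurable φ (volume.restrict (Ioo 0 1)) :=
    aemeasurable_restrict_of_monotoneOn measurableSet_Ioo hφmono
  have hωm : AEMeasurable (fun s : ℝ => ENNReal.ofReal (ω (s:ℂ))) (volume.restrict (Ioo 0 1)) :=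
    h.integrableOn_Ioo.aestronglyMeasurable.aemeasurable.ennreal_ofReal
  have hwm : AEMeasurable (fun s : ℝ => ENNReal.ofReal (what ω s / (1 - s)))
      (volume.restrict (Ioo 0 1)) := by
    refine AEMeasurable.ennreal_ofReal (AEMeasurable.div ?_ (by fun_prop))
    exact aemeasurable_restrict_of_antitoneOn measurableSet_Ioo
      ((what_antitoneOn hω.1 h).mono Ioo_subset_Icc_self)
  have eL := lintegral_ball_radial_mul (c := 0) (R := 1) hwm
    (G := fun ζ => ‖g ζ‖ ^ p) (fun ζ => by positivity) hcont
  have eR := lintegral_ball_radial_mul (c := 0) (R := 1) hωm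
    (G := fun ζ => ‖g ζ‖ ^ p) (fun ζ => by positivity) hcont
  simp only [sub_zero] at eL eR
  simp only [← hω.2.1] at eR
  rw [lintegral_restrict_dA, lintegral_restrict_dA, UD, eL, eR, mul_left_comm]
  gcongr
  set S : Set (ℝ × ℝ) := {x | x.1 < x.2 ∧ x.2 ≤ 1 - (1 - x.1) / K} with hS
  have hSm : MeasurableSet S :=
    (measurableSet_lt measurable_fst measurable_snd).inter
      (measurableSet_le measurable_snd (by fun_prop))
  calc ∫⁻ s in Ioo (0:ℝ) 1, ENNReal.ofReal (what ω s / (1 - s)) * φ s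
      ≤ ∫⁻ s in Ioo (0:ℝ) 1, ∫⁻ t in Ioo (0:ℝ) 1,
          S.indicator (fun x => ENNReal.ofReal (c⁻¹ * (1 - x.1)⁻¹) *
            (ENNReal.ofReal (ω (x.2 : ℂ)) * φ x.2)) (s, t) := by
        refine setLIntegral_mono' measurableSet_Ioo fun s hs => ?_
        have hs' : 0 < 1 - s := by linarith [hs.2]
        have hq0 : 0 < (1 - s) / K := div_pos hs' hK0
        have hsub : Ioc s (1 - (1 - s) / K) ⊆ Ioo 0 1 := fun t ht =>
          ⟨hs.1.trans ht.1, by linarith [ht.2]⟩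
        have hb := hbox s hs.1.le hs.2
        calc ENNReal.ofReal (what ω s / (1 - s)) * φ s
            = ENNReal.ofReal (c⁻¹ * (1 - s)⁻¹) * φ s * ENNReal.ofReal (c * what ω s) := by
              generalize φ s = y
              rw [mul_right_comm, ← ENNReal.ofReal_mul (by positivity)]
              congr 2
              field_simp
          _ ≤ ENNReal.ofReal (c⁻¹ * (1 - s)⁻¹) * φ s *
                ∫⁻ t in Ioc s (1 - (1 - s) / K), ENNReal.ofReal (ω (t : ℂ)) := by gcongr
          _ = ∫⁻ t in Ioc s (1 - (1 - s) / K),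
                ENNReal.ofReal (c⁻¹ * (1 - s)⁻¹) * φ s * ENNReal.ofReal (ω (t : ℂ)) := by
              rw [lintegral_const_mul'' _ (hωm.mono_set hsub)]
          _ ≤ ∫⁻ t in Ioc s (1 - (1 - s) / K), ENNReal.ofReal (c⁻¹ * (1 - s)⁻¹) *
                (ENNReal.ofReal (ω (t : ℂ)) * φ t) := by
              refine setLIntegral_mono' measurableSet_Ioc fun t ht => ?_
              rw [mul_assoc, mul_comm (φ s)]
              gcongr
              exact hφmono hs (hsub ht) ht.1.le
          _ = ∫⁻ t in Ioc s (1 - (1 - s) / K), S.indicator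
                (fun x => ENNReal.ofReal (c⁻¹ * (1 - x.1)⁻¹) *
                  (ENNReal.ofReal (ω (x.2 : ℂ)) * φ x.2)) (s, t) := by
              refine setLIntegral_congr_fun measurableSet_Ioc fun t ht => ?_
              rw [indicator_of_mem (show (s, t) ∈ S from ht)]
          _ ≤ _ := lintegral_mono_set hsub
    _ = ∫⁻ t in Ioo (0:ℝ) 1, ∫⁻ s in Ioo (0:ℝ) 1,
          S.indicator (fun x => ENNReal.ofReal (c⁻¹ * (1 - x.1)⁻¹) *
            (ENNReal.ofReal (ω (x.2 : ℂ)) * φ x.2)) (s, t) := by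
        apply lintegral_lintegral_swap
        refine AEMeasurable.indicator (AEMeasurable.mul
          (f := fun x : ℝ × ℝ => ENNReal.ofReal (c⁻¹ * (1 - x.1)⁻¹))
          (Measurable.aemeasurable (by fun_prop)) ?_)
          hSm
        exact (hωm.comp_snd).mul (hφm.comp_snd)
    _ ≤ ∫⁻ t in Ioo (0:ℝ) 1, ENNReal.ofReal (c⁻¹ * K) * (ENNReal.ofReal (ω (t : ℂ)) * φ t) := by
        refine setLIntegral_mono' measurableSet_Ioo fun t ht => ?_
        have ht' : 0 < 1 - t := by linarith [ht.2]
        calc _ ≤ ∫⁻ s, (Ico (1 - K * (1 - t)) t).indicator (fun _ =>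
              ENNReal.ofReal (c⁻¹ * (1 - t)⁻¹) * (ENNReal.ofReal (ω (t : ℂ)) * φ t)) s := by
              refine (setLIntegral_le_lintegral _ _).trans (lintegral_mono fun s => ?_)
              by_cases hst : (s, t) ∈ S
              · have h1 : s < t := hst.1
                have h2 : t ≤ 1 - (1 - s) / K := hst.2
                have h3 : s ∈ Ico (1 - K * (1 - t)) t := by
                  refine ⟨?_, h1⟩
                  have : (1 - s) / K ≤ 1 - t := by linarith
                  rw [div_le_iff₀ hK0] at this
                  linarith
                rw [indicator_of_mem hst, indicator_of_mem h3]
                gcongr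
              · rw [indicator_of_notMem hst]
                exact zero_le
          _ ≤ _ := by
              generalize ENNReal.ofReal (ω (t : ℂ)) * φ t = y
              rw [lintegral_indicator measurableSet_Ico, setLIntegral_const, Real.volume_Ico,
                mul_right_comm, ← ENNReal.ofReal_mul (by positivity)]
              refine mul_le_mul_left (ENNReal.ofReal_le_ofReal ?_) _
              calc c⁻¹ * (1 - t)⁻¹ * (t - (1 - K * (1 - t)))
                  ≤ c⁻¹ * (1 - t)⁻¹ * (K * (1 - t)) := by gcongr; linarith
                _ = c⁻¹ * K := by field_simp
    _ = _ := by
        rw [lintegral_const_mul' _ _ ENNReal.ofReal_ne_top]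

theorem lintegral_lintegral_ball_le {W H : ℂ → ℝ≥0∞} (hW : AEMeasurable W (dA.restrict UD))
    (hH : AEMeasurable H (dA.restrict UD)) {r : ℝ} (hr : 2 ≤ r) :
    ∫⁻ z in UD, W z * ∫⁻ ζ in Metric.ball z ((1 - ‖z‖) / 2), H ζ ∂dA ∂dA ≤
      ∫⁻ ζ in UD, H ζ * ∫⁻ z in hDisc ζ r, W z ∂dA ∂dA := by
  set S : Set (ℂ × ℂ) := {x | dist x.2 x.1 < (1 - ‖x.1‖) / 2} with hS
  have hSm : MeasurableSet S := measurableSet_lt (by fun_prop) (by fun_prop)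
  calc _ = ∫⁻ z in UD, ∫⁻ ζ in UD, S.indicator (fun x => W x.1 * H x.2) (z, ζ) ∂dA ∂dA := by
        refine setLIntegral_congr_fun measurableSet_UD fun z hz => ?_
        have hsub := ball_half_subset_UD hz
        rw [← lintegral_const_mul'' _ (hH.mono_set hsub),
          ← inter_eq_left.mpr hsub, ← setLIntegral_indicator measurableSet_ball]
        rfl
    _ = ∫⁻ ζ in UD, ∫⁻ z in UD, S.indicator (fun x => W x.1 * H x.2) (z, ζ) ∂dA ∂dA := by
        apply lintegral_lintegral_swap
        exact ((hW.comp_fst).mul (hH.comp_snd)).indicator hSm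
    _ ≤ _ := by
        refine setLIntegral_mono' measurableSet_UD fun ζ hζ => ?_
        rw [← lintegral_const_mul'' _ (hW.mono_set (hDisc_subset_UD ζ r)),
          ← lintegral_indicator measurableSet_UD,
          ← lintegral_indicator (measurableSet_hDisc ζ r)]
        refine lintegral_mono fun z => ?_
        by_cases hz : z ∈ UD
        · rw [indicator_of_mem hz]
          by_cases hzS : (z, ζ) ∈ S
          · rw [indicator_of_mem hzS, indicator_of_mem, mul_comm]
            exact mem_hDisc_comm hz (ball_half_subset_hDisc hz hr hzS)
          · rw [indicator_of_notMem hzS]; exact zero_le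
        · rw [indicator_of_notMem hz]; exact zero_le

/-- The Carleson-type condition on the density `F` with exponent `s` over hyperbolic discs of
radius `r`. -/
def CarlesonBound (ω F : ℂ → ℝ) (s r : ℝ) : Prop :=
  ∃ C > (0 : ℝ), ∀ z ∈ UD,
    ∫ ζ in hDisc z r, F ζ ∂dA ≤ C * (what ω ‖z‖ * (1 - ‖z‖)) ^ s

theorem WhatPos.pos_norm {ω : ℂ → ℝ} (h : WhatPos ω) {z : ℂ} (hz : z ∈ UD) : 0 < what ω ‖z‖ :=
  h _ (norm_nonneg z) (by linarith [one_sub_norm_pos hz])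

theorem rpow_le_of_comparable {a b L : ℝ} (ha : 0 < a) (hb : 0 < b) (hL : 1 ≤ L)
    (h1 : a ≤ L * b) (h2 : b ≤ L * a) (e : ℝ) : a ^ e ≤ L ^ |e| * b ^ e := by
  have hL0 : 0 < L := by linarith
  rcases le_total 0 e with he | he
  · rw [abs_of_nonneg he, ← Real.mul_rpow hL0.le hb.le]
    exact Real.rpow_le_rpow ha.le h1 he
  · rw [abs_of_nonpos he]
    have : (L * a) ^ e ≤ b ^ e := Real.rpow_le_rpow_of_nonpos hb h2 he
    rw [Real.mul_rpow hL0.le ha.le] at this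
    rw [Real.rpow_neg hL0.le, inv_mul_eq_div, le_div_iff₀ (by positivity)]
    linarith

theorem what_le_of_comparable {ω : ℂ → ℝ} (hω : RadialWeight ω) (h : WhatPos ω) {β : ℝ}
    (hβ0 : 0 ≤ β) (hβ : DhatExp ω β) (κ : ℝ) :
    ∃ C ≥ (1:ℝ), ∀ z ∈ UD, ∀ ζ ∈ UD, 1 - ‖z‖ ≤ κ * (1 - ‖ζ‖) →
      what ω ‖z‖ ≤ C * what ω ‖ζ‖ := by
  obtain ⟨C, hC, hexp⟩ := hβ
  refine ⟨max 1 (C * κ ^ β), le_max_left _ _, fun z hz ζ hζ hle => ?_⟩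
  have hz' := one_sub_norm_pos hz
  have hζ' := one_sub_norm_pos hζ
  have hw := h.pos_norm hζ
  rcases le_total ‖ζ‖ ‖z‖ with hc | hc
  · calc what ω ‖z‖ ≤ 1 * what ω ‖ζ‖ := by
          rw [one_mul]
          exact what_antitoneOn hω.1 h ⟨norm_nonneg _, by linarith⟩ ⟨norm_nonneg _, by linarith⟩ hc
      _ ≤ _ := by gcongr; exact le_max_left _ _
  · calc what ω ‖z‖ ≤ C * ((1 - ‖z‖) / (1 - ‖ζ‖)) ^ β * what ω ‖ζ‖ :=
          hexp _ _ (norm_nonneg _) hc (by linarith)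
      _ ≤ C * κ ^ β * what ω ‖ζ‖ := by
          gcongr
          rwa [div_le_iff₀ hζ']
      _ ≤ _ := by gcongr; exact le_max_right _ _

theorem ball_half_comparable {z ζ : ℂ} (h : ζ ∈ Metric.ball z ((1 - ‖z‖) / 2)) :
    1 - ‖z‖ ≤ 2 * (1 - ‖ζ‖) ∧ 1 - ‖ζ‖ ≤ 2 * (1 - ‖z‖) := by
  have h1 : ‖ζ - z‖ < (1 - ‖z‖) / 2 := by simpa [dist_eq_norm] using h
  have h2 := norm_sub_norm_le ζ z
  have h3 := norm_sub_norm_le z ζ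
  rw [norm_sub_rev] at h3
  have := norm_nonneg (ζ - z)
  constructor <;> linarith

theorem aemeasurable_what_norm {ω : ℂ → ℝ} (h0 : ∀ z, 0 ≤ ω z) (h : WhatPos ω) :
    AEMeasurable (fun ζ : ℂ => what ω ‖ζ‖) (dA.restrict UD) := by
  refine ((measurable_what_clamp h0 h).comp measurable_norm).aemeasurable.congr ?_
  filter_upwards [ae_restrict_mem measurableSet_UD] with ζ hζ
  exact what_clamp (norm_nonneg _) (by linarith [one_sub_norm_pos hζ])

/-- Integration against a Carleson density, for functions dominated by local averages. -/
theorem lintegral_le_of_carlesonBound {ω F : ℂ → ℝ} {s r C : ℝ} (hF0 : ∀ ζ, 0 ≤ F ζ)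
    (hF : IntegrableOn F UD dA) (hr : 2 ≤ r)
    (hC : ∀ z ∈ UD, ∫ ζ in hDisc z r, F ζ ∂dA ≤ C * (what ω ‖z‖ * (1 - ‖z‖)) ^ s)
    {U H : ℂ → ℝ≥0∞} (hH : AEMeasurable H (dA.restrict UD))
    (hU : ∀ z ∈ UD, U z ≤ ∫⁻ ζ in Metric.ball z ((1 - ‖z‖) / 2), H ζ ∂dA) :
    ∫⁻ z in UD, ENNReal.ofReal (F z) * U z ∂dA ≤
      ∫⁻ ζ in UD, H ζ * ENNReal.ofReal (C * (what ω ‖ζ‖ * (1 - ‖ζ‖)) ^ s) ∂dA := by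
  calc _ ≤ ∫⁻ z in UD, ENNReal.ofReal (F z) *
          ∫⁻ ζ in Metric.ball z ((1 - ‖z‖) / 2), H ζ ∂dA ∂dA := by
        refine setLIntegral_mono' measurableSet_UD fun z hz => ?_
        gcongr
        exact hU z hz
    _ ≤ _ := lintegral_lintegral_ball_le hF.aestronglyMeasurable.aemeasurable.ennreal_ofReal hH hr
    _ ≤ _ := by
        refine setLIntegral_mono' measurableSet_UD fun ζ hζ => ?_
        gcongr
        rw [← ofReal_setIntegral_hDisc hF0 hF]
        exact ENNReal.ofReal_le_ofReal (hC ζ hζ)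

theorem ofReal_setIntegral_norm_rpow {p : ℝ} {ω : ℂ → ℝ} (h0 : ∀ z, 0 ≤ ω z) {g : ℂ → ℂ}
    (hg : MemAp p ω g) :
    ENNReal.ofReal (∫ ζ in UD, ‖g ζ‖ ^ p * ω ζ ∂dA) =
      ∫⁻ ζ in UD, ENNReal.ofReal (ω ζ) * ENNReal.ofReal (‖g ζ‖ ^ p) ∂dA := by
  rw [ofReal_integral_eq_lintegral_ofReal hg.2
    (Filter.Eventually.of_forall fun ζ => mul_nonneg (by positivity) (h0 ζ))]
  refine lintegral_congr fun ζ => ?_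
  rw [mul_comm, ENNReal.ofReal_mul (h0 ζ)]

/-- Pointwise growth of functions in `A^p_ω`. -/
theorem exists_pointwise_bound {ω : ℂ → ℝ} (hω : RadialWeight ω) (h : WhatPos ω)
    (hD : Dcheck ω) {β : ℝ} (hβ0 : 0 ≤ β) (hβ : DhatExp ω β) {p : ℝ} (hp : 0 < p) :
    ∃ C > (0:ℝ), ∀ g : ℂ → ℂ, MemAp p ω g → ∀ z ∈ UD,
      ‖g z‖ ^ p * (what ω ‖z‖ * (1 - ‖z‖)) ≤ C * ∫ ζ in UD, ‖g ζ‖ ^ p * ω ζ ∂dA := by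
  obtain ⟨C1, hC1, hA⟩ := exists_lintegral_what_div_le hω h hD hp
  obtain ⟨C2, hC2, hw⟩ := what_le_of_comparable hω h hβ0 hβ 2
  have hC20 : 0 < C2 := by linarith
  refine ⟨8 * C2 * C1, by positivity, fun g hg z hz => ?_⟩
  set E := ∫ ζ in UD, ‖g ζ‖ ^ p * ω ζ ∂dA with hE
  have hE0 : 0 ≤ E := integral_nonneg fun ζ => mul_nonneg (by positivity) (hω.1 ζ)
  have hz' := one_sub_norm_pos hz
  have hwz := h.pos_norm hz
  have hsub := ball_half_subset_UD hz
  have hmain : ENNReal.ofReal (‖g z‖ ^ p) ≤ ENNReal.ofReal (4 * (1 - ‖z‖) ^ (-2 : ℝ) *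
      (2 * C2 * (1 - ‖z‖) / what ω ‖z‖) * (C1 * E)) := by
    calc _ ≤ _ := norm_rpow_le_lintegral_ball hg.1 hp hz
      _ ≤ ENNReal.ofReal (4 * (1 - ‖z‖) ^ (-2 : ℝ)) *
          (ENNReal.ofReal (2 * C2 * (1 - ‖z‖) / what ω ‖z‖) *
            (ENNReal.ofReal C1 * ENNReal.ofReal E)) := by
          gcongr
          calc _ ≤ ∫⁻ ζ in Metric.ball z ((1 - ‖z‖) / 2),
                  ENNReal.ofReal (2 * C2 * (1 - ‖z‖) / what ω ‖z‖) *
                  (ENNReal.ofReal (what ω ‖ζ‖ / (1 - ‖ζ‖)) * ENNReal.ofReal (‖g ζ‖ ^ p)) ∂dA := by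
                refine setLIntegral_mono' measurableSet_ball fun ζ hζ => ?_
                have hζU := hsub hζ
                obtain ⟨c1, c2⟩ := ball_half_comparable hζ
                have hζ' := one_sub_norm_pos hζU
                have hwζ := hw z hz ζ hζU c1
                rw [← mul_assoc, ← ENNReal.ofReal_mul (by positivity)]
                refine le_mul_of_one_le_left zero_le ?_
                rw [ENNReal.one_le_ofReal, div_mul_div_comm, one_le_div (by positivity)]
                nlinarith
            _ ≤ _ := by
                rw [lintegral_const_mul' _ _ ENNReal.ofReal_ne_top]
                gcongr
                rw [hE, ofReal_setIntegral_norm_rpow hω.1 hg]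
                exact (lintegral_mono_set hsub).trans (hA g hg.1)
      _ = _ := by
          rw [← ENNReal.ofReal_mul hC1.le, ← ENNReal.ofReal_mul (by positivity),
            ← ENNReal.ofReal_mul (by positivity)]
          congr 1
          ring
  rw [ENNReal.ofReal_le_ofReal_iff (by positivity)] at hmain
  calc _ ≤ (4 * (1 - ‖z‖) ^ (-2 : ℝ) * (2 * C2 * (1 - ‖z‖) / what ω ‖z‖) * (C1 * E)) *
        (what ω ‖z‖ * (1 - ‖z‖)) := by gcongr
    _ = _ := by
        rw [Real.rpow_neg hz'.le, Real.rpow_two]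
        field_simp
        ring

/-- The Carleson condition gives the embedding of `A^p_ω`. -/
theorem CarlesonBound.embedding {ω F : ℂ → ℝ} {p s r : ℝ} (hω : RadialWeight ω) (h : WhatPos ω)
    (hD : Dcheck ω) {β : ℝ} (hβ0 : 0 ≤ β) (hβ : DhatExp ω β) (hp : 0 < p) (hs : 1 ≤ s)
    (hF0 : ∀ ζ, 0 ≤ F ζ) (hF : IntegrableOn F UD dA) (hr : 2 ≤ r) (hB : CarlesonBound ω F s r) :
    ∃ C > (0:ℝ), ∀ g : ℂ → ℂ, MemAp p ω g →
      ∫⁻ z in UD, ENNReal.ofReal (‖g z‖ ^ (p * s) * F z) ∂dA ≤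
        ENNReal.ofReal (C * (∫ ζ in UD, ‖g ζ‖ ^ p * ω ζ ∂dA) ^ s) := by
  obtain ⟨C, hC, hB⟩ := hB
  obtain ⟨C0, hC0, hpt⟩ := exists_pointwise_bound hω h hD hβ0 hβ hp
  obtain ⟨C1, hC1, hA⟩ := exists_lintegral_what_div_le hω h hD hp
  obtain ⟨C2, hC2, hw⟩ := what_le_of_comparable hω h hβ0 hβ 2
  have hC20 : 0 < C2 := by linarith
  set L := 2 * C2
  have hL : 1 ≤ L := by linarith
  set D := L ^ |1 - s| * 16 with hDdef
  refine ⟨C0 ^ (s - 1) * (D * C * C1), by positivity, fun g hg => ?_⟩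
  set E := ∫ ζ in UD, ‖g ζ‖ ^ p * ω ζ ∂dA with hE
  have hE0 : 0 ≤ E := integral_nonneg fun ζ => mul_nonneg (by positivity) (hω.1 ζ)
  set U : ℂ → ℝ≥0∞ := fun z =>
    ENNReal.ofReal ((what ω ‖z‖ * (1 - ‖z‖)) ^ (1 - s)) * ENNReal.ofReal (‖g z‖ ^ p)
  set H : ℂ → ℝ≥0∞ := fun ζ => ENNReal.ofReal (D * ((what ω ‖ζ‖ * (1 - ‖ζ‖)) ^ (1 - s) *
    (1 - ‖ζ‖) ^ (-2 : ℝ))) * ENNReal.ofReal (‖g ζ‖ ^ p)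
  have hwm := aemeasurable_what_norm hω.1 h
  have hgm : AEMeasurable (fun ζ => ENNReal.ofReal (‖g ζ‖ ^ p)) (dA.restrict UD) :=
    (((hg.1.continuousOn.norm).rpow_const fun _ _ => Or.inr hp.le).aemeasurable
      measurableSet_UD).ennreal_ofReal
  have h1m : AEMeasurable (fun ζ : ℂ => 1 - ‖ζ‖) (dA.restrict UD) := by fun_prop
  have hHm : AEMeasurable H (dA.restrict UD) :=
    ((((hwm.mul h1m).pow_const _).mul (h1m.pow_const _)).const_mul D).ennreal_ofReal.mul hgm
  have hUH : ∀ z ∈ UD, U z ≤ ∫⁻ ζ in Metric.ball z ((1 - ‖z‖) / 2), H ζ ∂dA := by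
    intro z hz
    have hz' := one_sub_norm_pos hz
    have hwz := h.pos_norm hz
    calc U z ≤ ENNReal.ofReal ((what ω ‖z‖ * (1 - ‖z‖)) ^ (1 - s)) *
          (ENNReal.ofReal (4 * (1 - ‖z‖) ^ (-2 : ℝ)) *
            ∫⁻ ζ in Metric.ball z ((1 - ‖z‖) / 2), ENNReal.ofReal (‖g ζ‖ ^ p) ∂dA) := by
          exact mul_le_mul_right (norm_rpow_le_lintegral_ball hg.1 hp hz) _
      _ = ∫⁻ ζ in Metric.ball z ((1 - ‖z‖) / 2), ENNReal.ofReal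
            ((what ω ‖z‖ * (1 - ‖z‖)) ^ (1 - s) * (4 * (1 - ‖z‖) ^ (-2 : ℝ))) *
              ENNReal.ofReal (‖g ζ‖ ^ p) ∂dA := by
          rw [← mul_assoc, ← ENNReal.ofReal_mul (by positivity),
            lintegral_const_mul' _ _ ENNReal.ofReal_ne_top]
      _ ≤ _ := by
          refine setLIntegral_mono' measurableSet_ball fun ζ hζ => ?_
          have hζU := ball_half_subset_UD hz hζ
          obtain ⟨c1, c2⟩ := ball_half_comparable hζ
          have hζ' := one_sub_norm_pos hζU
          have hwζ := h.pos_norm hζU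
          have w1 := hw z hz ζ hζU c1
          have w2 := hw ζ hζU z hz c2
          have k1 : (what ω ‖z‖ * (1 - ‖z‖)) ^ (1 - s) ≤
              L ^ |1 - s| * (what ω ‖ζ‖ * (1 - ‖ζ‖)) ^ (1 - s) := by
            apply rpow_le_of_comparable (by positivity) (by positivity) hL
            · calc _ ≤ (C2 * what ω ‖ζ‖) * (2 * (1 - ‖ζ‖)) := by gcongr
                _ = _ := by ring
            · calc _ ≤ (C2 * what ω ‖z‖) * (2 * (1 - ‖z‖)) := by gcongr
                _ = _ := by ring
          have k2 : (1 - ‖z‖) ^ (-2 : ℝ) ≤ 4 * (1 - ‖ζ‖) ^ (-2 : ℝ) := by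
            have := rpow_le_of_comparable hz' hζ' one_le_two c1 c2 (-2)
            norm_num at this ⊢
            exact this
          simp only [H]
          refine mul_le_mul_left (ENNReal.ofReal_le_ofReal ?_) _
          calc _ ≤ (L ^ |1 - s| * (what ω ‖ζ‖ * (1 - ‖ζ‖)) ^ (1 - s)) *
                (4 * (4 * (1 - ‖ζ‖) ^ (-2 : ℝ))) :=
                  mul_le_mul k1 (by linarith) (by positivity) (by positivity)
            _ = _ := by rw [hDdef]; ring
  have hmain : ∫⁻ z in UD, ENNReal.ofReal (F z) * U z ∂dA ≤ ENNReal.ofReal (D * C * C1 * E) := by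
    calc _ ≤ _ := lintegral_le_of_carlesonBound hF0 hF hr hB hHm hUH
      _ ≤ ENNReal.ofReal (D * C) * ∫⁻ ζ in UD, ENNReal.ofReal (what ω ‖ζ‖ / (1 - ‖ζ‖)) *
            ENNReal.ofReal (‖g ζ‖ ^ p) ∂dA := by
          rw [← lintegral_const_mul' _ _ ENNReal.ofReal_ne_top]
          refine setLIntegral_mono' measurableSet_UD fun ζ hζ => le_of_eq ?_
          have hζ' := one_sub_norm_pos hζ
          have hwζ := h.pos_norm hζ
          simp only [H]
          rw [mul_right_comm, ← mul_assoc (ENNReal.ofReal (D * C))]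
          congr 1
          rw [← ENNReal.ofReal_mul (by positivity), ← ENNReal.ofReal_mul (by positivity)]
          congr 1
          have e1 : (what ω ‖ζ‖ * (1 - ‖ζ‖)) ^ (1 - s) * (what ω ‖ζ‖ * (1 - ‖ζ‖)) ^ s =
              what ω ‖ζ‖ * (1 - ‖ζ‖) := by
            rw [← Real.rpow_add (by positivity), sub_add_cancel, Real.rpow_one]
          calc _ = D * C * ((what ω ‖ζ‖ * (1 - ‖ζ‖)) ^ (1 - s) *
                (what ω ‖ζ‖ * (1 - ‖ζ‖)) ^ s) * (1 - ‖ζ‖) ^ (-2 : ℝ) := by ring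
            _ = _ := by
                rw [e1, Real.rpow_neg hζ'.le, Real.rpow_two]
                field_simp
      _ ≤ ENNReal.ofReal (D * C) * (ENNReal.ofReal C1 * ENNReal.ofReal E) := by
          gcongr
          rw [hE, ofReal_setIntegral_norm_rpow hω.1 hg]
          exact hA g hg.1
      _ = _ := by
          rw [← ENNReal.ofReal_mul hC1.le, ← ENNReal.ofReal_mul (by positivity), mul_assoc (D * C)]
  calc _ ≤ ∫⁻ z in UD, ENNReal.ofReal ((C0 * E) ^ (s - 1)) *
          (ENNReal.ofReal (F z) * U z) ∂dA := by
        refine setLIntegral_mono' measurableSet_UD fun z hz => ?_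
        have hz' := one_sub_norm_pos hz
        have hwz := h.pos_norm hz
        simp only [U]
        rw [← ENNReal.ofReal_mul (by positivity), ← ENNReal.ofReal_mul (hF0 z),
          ← ENNReal.ofReal_mul (by positivity)]
        apply ENNReal.ofReal_le_ofReal
        have hb := hpt g hg z hz
        have hX : 0 < what ω ‖z‖ * (1 - ‖z‖) := by positivity
        have k1 : (‖g z‖ ^ p) ^ (s - 1) ≤
            (C0 * E) ^ (s - 1) * (what ω ‖z‖ * (1 - ‖z‖)) ^ (1 - s) := by
          rw [show 1 - s = -(s - 1) by ring, Real.rpow_neg hX.le, ← div_eq_mul_inv,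
            ← Real.div_rpow (by positivity) hX.le]
          apply Real.rpow_le_rpow (by positivity) _ (by linarith)
          rwa [le_div_iff₀ hX]
        have k2 : ‖g z‖ ^ (p * s) = ‖g z‖ ^ p * (‖g z‖ ^ p) ^ (s - 1) := by
          rw [Real.rpow_mul (norm_nonneg _)]
          nth_rewrite 2 [← Real.rpow_one (‖g z‖ ^ p)]
          rw [← Real.rpow_add' (by positivity) (by linarith), add_sub_cancel]
        rw [k2]
        have := hF0 z
        calc _ ≤ ‖g z‖ ^ p * ((C0 * E) ^ (s - 1) * (what ω ‖z‖ * (1 - ‖z‖)) ^ (1 - s)) * F z := by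
              gcongr
          _ = _ := by ring
    _ ≤ ENNReal.ofReal ((C0 * E) ^ (s - 1)) * ENNReal.ofReal (D * C * C1 * E) := by
        rw [lintegral_const_mul' _ _ ENNReal.ofReal_ne_top]
        gcongr
    _ = _ := by
        rw [← ENNReal.ofReal_mul (by positivity), Real.mul_rpow hC0.le hE0]
        congr 1
        have : E ^ s = E ^ (s - 1) * E := by
          nth_rewrite 3 [← Real.rpow_one E]
          rw [← Real.rpow_add' hE0 (by linarith), sub_add_cancel]
        rw [this]; ring

theorem one_sub_norm_sq_comparable {z : ℂ} (hz : z ∈ UD) :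
    1 - ‖z‖ ≤ 1 - ‖z‖ ^ 2 ∧ 1 - ‖z‖ ^ 2 ≤ 2 * (1 - ‖z‖) := by
  have := one_sub_norm_pos hz
  have := norm_nonneg z
  constructor <;> nlinarith

theorem norm_one_sub_conj_mul_pos {z ζ : ℂ} (hz : z ∈ UD) (hζ : ζ ∈ UD) :
    0 < ‖1 - conj z * ζ‖ :=
  (one_sub_norm_pos hz).trans_le (one_sub_norm_le_kernel hζ)

theorem kernel_le_of_mem_ball_half {z ζ η : ℂ} (hz : z ∈ UD) (hζ : ζ ∈ UD)
    (h : η ∈ Metric.ball ζ ((1 - ‖ζ‖) / 2)) :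
    ‖1 - conj z * η‖ ≤ 2 * ‖1 - conj z * ζ‖ := by
  have h1 : ‖η - ζ‖ < (1 - ‖ζ‖) / 2 := by simpa [dist_eq_norm] using h
  have h2 : 1 - ‖ζ‖ ≤ ‖1 - conj z * ζ‖ := by
    rw [norm_one_sub_conj_mul_comm]
    exact one_sub_norm_le_kernel hz
  have h3 : ‖1 - conj z * η‖ ≤ ‖1 - conj z * ζ‖ + ‖conj z * (η - ζ)‖ := by
    rw [show 1 - conj z * η = (1 - conj z * ζ) - conj z * (η - ζ) by ring]
    exact norm_sub_le _ _
  have h4 : ‖conj z * (η - ζ)‖ ≤ ‖η - ζ‖ := by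
    rw [norm_mul, RCLike.norm_conj]
    exact mul_le_of_le_one_left (norm_nonneg _) (by linarith [one_sub_norm_pos hz])
  have := one_sub_norm_pos hζ
  linarith

theorem rpow_mul_rpow_le_of_exp {a t W w C γ s e : ℝ} (ha : 0 < 1 - a) (ht : 0 < 1 - t)
    (hC : 0 ≤ C) (hW : 0 ≤ W) (hw : 0 ≤ w) (hs : 0 ≤ s)
    (h : w ≤ C * ((1 - t) / (1 - a)) ^ γ * W) :
    w ^ s * (1 - t) ^ e ≤
      C ^ s * ((1 - t) / (1 - a)) ^ (s * γ + e) * (W ^ s * (1 - a) ^ e) := by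
  have hτ : 0 < (1 - t) / (1 - a) := by positivity
  calc w ^ s * (1 - t) ^ e ≤ (C * ((1 - t) / (1 - a)) ^ γ * W) ^ s * (1 - t) ^ e := by gcongr
    _ = C ^ s * ((1 - t) / (1 - a)) ^ (s * γ) * W ^ s * (((1 - t) / (1 - a)) * (1 - a)) ^ e := by
        rw [div_mul_cancel₀ _ ha.ne', Real.mul_rpow (by positivity) hW,
          Real.mul_rpow hC (by positivity), ← Real.rpow_mul hτ.le, mul_comm γ]
    _ = _ := by
        rw [Real.mul_rpow hτ.le ha.le, Real.rpow_add hτ]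
        ring

/-- The Carleson condition controls the integrals of the kernels in the Berezin transform. -/
theorem CarlesonBound.lintegral_kernel_le {ω F : ℂ → ℝ} {s r α β σ c : ℝ}
    (h : WhatPos ω) (hα : DcheckExp ω α) (hβ : DhatExp ω β)
    (hs : 0 < s) (hσ : 1 - s * (1 + α) < σ) (hc : max (-1 - σ) (s * (1 + β) - 2) < c)
    (hF0 : ∀ ζ, 0 ≤ F ζ) (hF : IntegrableOn F UD dA) (hr : 2 ≤ r) (hB : CarlesonBound ω F s r) :
    ∃ C > (0:ℝ), ∀ z ∈ UD,
      ∫⁻ ζ in UD, ENNReal.ofReal (F ζ) *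
        ENNReal.ofReal ((1 - ‖ζ‖ ^ 2) ^ σ * ‖1 - conj z * ζ‖ ^ (-(2 + c + σ))) ∂dA ≤
        ENNReal.ofReal (C * (what ω ‖z‖ ^ s * (1 - ‖z‖) ^ (s - 2 - c))) := by
  obtain ⟨C, hC, hB⟩ := hB
  obtain ⟨Cα, hCα, hα⟩ := hα
  obtain ⟨Cβ, hCβ, hβ⟩ := hβ
  obtain ⟨hc1, hc2⟩ := max_lt_iff.1 hc
  set x := 2 + c + σ with hx
  have hx1 : 1 < x := by linarith
  set D := (4 : ℝ) ^ |σ| * 2 ^ x * 16 with hD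
  have hD0 : 0 < D := by positivity
  set e := s + σ - 2 with he
  set V : ℝ → ℝ := fun t => what ω t ^ s * (1 - t) ^ e with hV
  set W : ℝ → ℝ≥0∞ := fun t => ENNReal.ofReal (D * C) * ENNReal.ofReal (V t) with hW
  set K := Cα ^ s + Cβ ^ s
  have hK : 0 < K := by positivity
  have hA : 0 < s * α + e + 1 := by rw [he]; linarith
  have hB' : 0 < x - 1 - (s * β + e) - 1 := by rw [he, hx]; linarith
  have hV0 : ∀ t, 0 ≤ t → t < 1 → 0 ≤ V t := fun t h0 h1 =>
    mul_nonneg (Real.rpow_nonneg (h t h0 h1).le _) (Real.rpow_nonneg (by linarith) _)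
  refine ⟨Real.pi⁻¹ * (2 * 10 ^ x / (x - 1)) * (D * C) *
    (K * (1 / (s * α + e + 1) + 1 / (x - 1 - (s * β + e) - 1))), ?_, fun z hz => ?_⟩
  · have : 0 < x - 1 := by linarith
    positivity
  have hz' := one_sub_norm_pos hz
  have hwz := h.pos_norm hz
  set H : ℂ → ℝ≥0∞ := fun η =>
    ENNReal.ofReal (D * (1 - ‖η‖) ^ (σ - 2)) * ENNReal.ofReal (‖1 - conj z * η‖ ^ (-x)) with hH
  have hHm : AEMeasurable H (dA.restrict UD) := by fun_prop
  have hUH : ∀ ζ ∈ UD, ENNReal.ofReal ((1 - ‖ζ‖ ^ 2) ^ σ * ‖1 - conj z * ζ‖ ^ (-x)) ≤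
      ∫⁻ η in Metric.ball ζ ((1 - ‖ζ‖) / 2), H η ∂dA := by
    intro ζ hζ
    have hζ' := one_sub_norm_pos hζ
    obtain ⟨q1, q2⟩ := one_sub_norm_sq_comparable hζ
    have hk := norm_one_sub_conj_mul_pos hz hζ
    have hone := norm_rpow_le_lintegral_ball (g := fun _ => 1) (differentiableOn_const 1)
      one_pos hζ
    simp only [norm_one, Real.one_rpow, ENNReal.ofReal_one] at hone
    calc _ ≤ ENNReal.ofReal ((1 - ‖ζ‖ ^ 2) ^ σ * ‖1 - conj z * ζ‖ ^ (-x)) *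
          (ENNReal.ofReal (4 * (1 - ‖ζ‖) ^ (-2 : ℝ)) *
            ∫⁻ _ in Metric.ball ζ ((1 - ‖ζ‖) / 2), 1 ∂dA) := le_mul_of_one_le_right zero_le hone
      _ = ∫⁻ _ in Metric.ball ζ ((1 - ‖ζ‖) / 2), ENNReal.ofReal
            ((1 - ‖ζ‖ ^ 2) ^ σ * ‖1 - conj z * ζ‖ ^ (-x) * (4 * (1 - ‖ζ‖) ^ (-2 : ℝ))) * 1 ∂dA := by
          have : 0 ≤ (1 - ‖ζ‖ ^ 2) ^ σ := Real.rpow_nonneg (by linarith) _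
          rw [← mul_assoc, ← ENNReal.ofReal_mul (by positivity),
            lintegral_const_mul' _ _ ENNReal.ofReal_ne_top]
      _ ≤ _ := by
          refine setLIntegral_mono' measurableSet_ball fun η hη => ?_
          have hηU := ball_half_subset_UD hζ hη
          obtain ⟨c1, c2⟩ := ball_half_comparable hη
          have hη' := one_sub_norm_pos hηU
          have hkη := norm_one_sub_conj_mul_pos hz hηU
          have k1 : (1 - ‖ζ‖ ^ 2) ^ σ ≤ 4 ^ |σ| * (1 - ‖η‖) ^ σ :=
            rpow_le_of_comparable (by linarith) hη' (by norm_num) (by linarith) (by linarith) σ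
          have k2 : (1 - ‖ζ‖) ^ (-2 : ℝ) ≤ 4 * (1 - ‖η‖) ^ (-2 : ℝ) := by
            have := rpow_le_of_comparable hζ' hη' one_le_two c1 c2 (-2)
            norm_num at this ⊢
            exact this
          have k3 : ‖1 - conj z * ζ‖ ^ (-x) ≤ 2 ^ x * ‖1 - conj z * η‖ ^ (-x) := by
            have := Real.rpow_le_rpow_of_nonpos hkη (kernel_le_of_mem_ball_half hz hζ hη)
              (by linarith : -x ≤ 0)
            rw [Real.mul_rpow two_pos.le hk.le, Real.rpow_neg two_pos.le] at this
            rwa [← div_le_iff₀' (by positivity), div_eq_inv_mul]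
          have k4 : (1 - ‖η‖) ^ (σ - 2) = (1 - ‖η‖) ^ σ * (1 - ‖η‖) ^ (-2 : ℝ) := by
            rw [← Real.rpow_add hη', ← sub_eq_add_neg]
          simp only [H]
          rw [mul_one, ← ENNReal.ofReal_mul (by positivity), k4]
          apply ENNReal.ofReal_le_ofReal
          calc _ ≤ (4 ^ |σ| * (1 - ‖η‖) ^ σ) * (2 ^ x * ‖1 - conj z * η‖ ^ (-x)) *
                (4 * (4 * (1 - ‖η‖) ^ (-2 : ℝ))) := by gcongr
            _ = _ := by rw [hD]; ring
  calc _ ≤ _ := lintegral_le_of_carlesonBound hF0 hF hr hB hHm hUH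
    _ = ∫⁻ η in UD, W ‖η‖ * ENNReal.ofReal (‖1 - conj z * η‖ ^ (-x)) ∂dA := by
        refine setLIntegral_congr_fun measurableSet_UD fun η hη => ?_
        have hη' := one_sub_norm_pos hη
        have hwη := h.pos_norm hη
        simp only [H, W, V]
        rw [mul_right_comm]
        congr 1
        rw [← ENNReal.ofReal_mul (by positivity), ← ENNReal.ofReal_mul (by positivity)]
        congr 1
        rw [Real.mul_rpow hwη.le hη'.le, he, show s + σ - 2 = s + (σ - 2) by ring,
          Real.rpow_add hη']
        ring
    _ ≤ _ := lintegral_radial_kernel_le hz hx1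
    _ = ENNReal.ofReal (Real.pi⁻¹ * (2 * 10 ^ x / (x - 1)) * (D * C)) * ∫⁻ t in Ioo (0 : ℝ) 1,
          ENNReal.ofReal (V t) * ENNReal.ofReal ((1 - ‖z‖ * t) ^ (-(x - 1))) := by
        have : 0 < x - 1 := by linarith
        simp only [hW, mul_assoc (ENNReal.ofReal (D * C))]
        rw [lintegral_const_mul' _ _ ENNReal.ofReal_ne_top, ← mul_assoc,
          ← ENNReal.ofReal_inv_of_pos Real.pi_pos, ← ENNReal.ofReal_mul (by positivity),
          ← ENNReal.ofReal_mul (by positivity), neg_sub]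
    _ ≤ ENNReal.ofReal (Real.pi⁻¹ * (2 * 10 ^ x / (x - 1)) * (D * C)) * ENNReal.ofReal
          (K * (1 / (s * α + e + 1) + 1 / (x - 1 - (s * β + e) - 1)) *
            (V ‖z‖ * (1 - ‖z‖) ^ (1 - (x - 1)))) := by
        refine mul_le_mul_right (lintegral_power_control_le (norm_nonneg z) (by linarith)
          (hV0 _ (norm_nonneg z) (by linarith)) hK.le (by linarith) (by linarith) (by linarith)
          (fun t hat ht1 => ?_) (fun t ht0 hta => ?_)) _
        · have ht0 : 0 ≤ t := (norm_nonneg z).trans hat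
          have ht' : 0 < 1 - t := by linarith
          have := hV0 _ (norm_nonneg z) (by linarith)
          refine (rpow_mul_rpow_le_of_exp (e := e) hz' ht' hCα.le hwz.le (h t ht0 ht1).le hs.le
            (hα _ _ (norm_nonneg z) hat ht1)).trans ?_
          gcongr
          exact le_add_of_nonneg_right (by positivity)
        · have ht' : 0 < 1 - t := by linarith
          have := hV0 _ (norm_nonneg z) (by linarith)
          refine (rpow_mul_rpow_le_of_exp (e := e) hz' ht' hCβ.le hwz.le
            (h t ht0 (by linarith)).le hs.le (γ := β) ?_).trans ?_
          · exact hβ _ _ ht0 hta (by linarith)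
          gcongr
          exact le_add_of_nonneg_left (by positivity)
    _ = _ := by
        have : 0 < x - 1 := by linarith
        rw [← ENNReal.ofReal_mul (by positivity), ← mul_assoc]
        congr 2
        simp only [V]
        rw [mul_assoc, ← Real.rpow_add hz']
        congr 2
        rw [he, hx]
        ring

theorem gam_rpow {ω ν : ℂ → ℝ} {p q : ℝ} (hq : 0 < q) (h : WhatPos ω) (hν : WhatPos ν)
    {z : ℂ} (hz : z ∈ UD) :
    gam ω ν p q z ^ q =
      what ν ‖z‖ * (1 - ‖z‖) / (what ω ‖z‖ * (1 - ‖z‖)) ^ (q / p) := by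
  have hz' := one_sub_norm_pos hz
  have hw := h.pos_norm hz
  have hn := hν.pos_norm hz
  rw [gam, ← Real.mul_rpow hn.le hz'.le, ← Real.mul_rpow hw.le hz'.le,
    Real.div_rpow (by positivity) (by positivity), ← Real.rpow_mul (by positivity),
    ← Real.rpow_mul (by positivity), one_div_mul_cancel hq.ne', Real.rpow_one, one_div_mul_eq_div]

theorem gam_pos {ω ν : ℂ → ℝ} {p q : ℝ} (h : WhatPos ω) (hν : WhatPos ν)
    {z : ℂ} (hz : z ∈ UD) : 0 < gam ω ν p q z := by
  have hz' := one_sub_norm_pos hz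
  have hw := h.pos_norm hz
  have hn := hν.pos_norm hz
  rw [gam]
  positivity

theorem gam_rpow_mul_Ber {ω ν φ : ℂ → ℝ} {p q c σ : ℝ} (hq : 0 < q) (h : WhatPos ω)
    (hν : WhatPos ν) {z : ℂ} (hz : z ∈ UD) :
    gam ω ν p q z ^ q * Ber ν c σ φ z =
      (1 - ‖z‖) * (1 - ‖z‖ ^ 2) ^ (c + 1) / (what ω ‖z‖ * (1 - ‖z‖)) ^ (q / p) *
        ∫ ζ in UD, φ ζ * ν ζ * ((1 - ‖ζ‖ ^ 2) ^ σ * ‖1 - conj z * ζ‖ ^ (-(2 + c + σ))) ∂dA := by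
  have hn := hν.pos_norm hz
  have hI : ∀ ζ : ℂ, φ ζ * (1 - ‖ζ‖ ^ 2) ^ σ * ‖1 - z * conj ζ‖ ^ (-(2 + c + σ)) * ν ζ =
      φ ζ * ν ζ * ((1 - ‖ζ‖ ^ 2) ^ σ * ‖1 - conj z * ζ‖ ^ (-(2 + c + σ))) := fun ζ => by
    rw [norm_one_sub_conj_mul_comm z ζ, mul_comm z]
    ring
  rw [gam_rpow hq h hν hz, Ber]
  simp only [hI]
  field_simp

theorem CarlesonBound.exists_gam_mul_Ber_le {ω ν φ : ℂ → ℝ} {p q r α β σ c : ℝ} (hp : 0 < p)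
    (hq : 0 < q) (h : WhatPos ω) (hα : DcheckExp ω α) (hβ : DhatExp ω β) (hν : WhatPos ν)
    (hσ : 1 - q / p * (1 + α) < σ) (hc : max (-1 - σ) (q / p * (1 + β) - 2) < c)
    (hF0 : ∀ ζ, 0 ≤ φ ζ * ν ζ) (hF : IntegrableOn (fun ζ => φ ζ * ν ζ) UD dA) (hr : 2 ≤ r)
    (hB : CarlesonBound ω (fun ζ => φ ζ * ν ζ) (q / p) r) :
    ∃ M : ℝ, ∀ z ∈ UD, gam ω ν p q z ^ q * Ber ν c σ φ z ≤ M := by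
  obtain ⟨C, hC, hk⟩ := hB.lintegral_kernel_le h hα hβ (div_pos hq hp) hσ hc hF0 hF hr
  refine ⟨2 ^ |c + 1| * C, fun z hz => ?_⟩
  have hz' := one_sub_norm_pos hz
  have hw := h.pos_norm hz
  obtain ⟨q1, q2⟩ := one_sub_norm_sq_comparable hz
  have hnn : ∀ᵐ ζ ∂dA.restrict UD, 0 ≤ φ ζ * ν ζ *
      ((1 - ‖ζ‖ ^ 2) ^ σ * ‖1 - conj z * ζ‖ ^ (-(2 + c + σ))) := by
    filter_upwards [ae_restrict_mem measurableSet_UD] with ζ hζ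
    have := one_sub_norm_pos hζ
    have := (one_sub_norm_sq_comparable hζ).1
    exact mul_nonneg (hF0 ζ) (mul_nonneg (Real.rpow_nonneg (by linarith) _) (by positivity))
  have hI0 := integral_nonneg_of_ae hnn
  have hI : ∫ ζ in UD, φ ζ * ν ζ *
      ((1 - ‖ζ‖ ^ 2) ^ σ * ‖1 - conj z * ζ‖ ^ (-(2 + c + σ))) ∂dA ≤
        C * (what ω ‖z‖ ^ (q / p) * (1 - ‖z‖) ^ (q / p - 2 - c)) := by
    by_cases hint : IntegrableOn (fun ζ => φ ζ * ν ζ *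
      ((1 - ‖ζ‖ ^ 2) ^ σ * ‖1 - conj z * ζ‖ ^ (-(2 + c + σ)))) UD dA
    · rw [← ENNReal.ofReal_le_ofReal_iff (by positivity),
        ofReal_integral_eq_lintegral_ofReal hint hnn]
      simpa only [ENNReal.ofReal_mul (hF0 _)] using hk z hz
    · rw [integral_undef hint]
      positivity
  have hk2 : (1 - ‖z‖ ^ 2) ^ (c + 1) ≤ 2 ^ |c + 1| * (1 - ‖z‖) ^ (c + 1) :=
    rpow_le_of_comparable (by linarith) hz' one_le_two q2 (by linarith) _
  have h2 : 0 ≤ (1 - ‖z‖ ^ 2) ^ (c + 1) := Real.rpow_nonneg (by linarith) _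
  rw [gam_rpow_mul_Ber hq h hν hz]
  calc _ ≤ (1 - ‖z‖) * (2 ^ |c + 1| * (1 - ‖z‖) ^ (c + 1)) /
          (what ω ‖z‖ * (1 - ‖z‖)) ^ (q / p) *
          (C * (what ω ‖z‖ ^ (q / p) * (1 - ‖z‖) ^ (q / p - 2 - c))) := by gcongr
    _ = 2 ^ |c + 1| * C * ((1 - ‖z‖) ^ (1 : ℝ) * (1 - ‖z‖) ^ (c + 1) *
          (1 - ‖z‖) ^ (q / p - 2 - c) * (1 - ‖z‖) ^ (-(q / p))) := by
        rw [Real.mul_rpow hw.le hz'.le, Real.rpow_neg hz'.le, Real.rpow_one]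
        field_simp
    _ = _ := by
        rw [← Real.rpow_add hz', ← Real.rpow_add hz', ← Real.rpow_add hz']
        ring_nf
        simp

/-- Testing the embedding on powers of the Cauchy kernel. -/
theorem carlesonBound_of_embedding {ω F : ℂ → ℝ} {p s β : ℝ} (hp : 0 < p) (hs : 0 < s)
    (hω : RadialWeight ω) (h : WhatPos ω) (hβ0 : 0 ≤ β) (hβ : DhatExp ω β)
    (hF0 : ∀ ζ, 0 ≤ F ζ) (hF : IntegrableOn F UD dA)
    (hE : ∃ C > (0:ℝ), ∀ g : ℂ → ℂ, MemAp p ω g →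
      ∫⁻ z in UD, ENNReal.ofReal (‖g z‖ ^ (p * s) * F z) ∂dA ≤
        ENNReal.ofReal (C * (∫ ζ in UD, ‖g ζ‖ ^ p * ω ζ ∂dA) ^ s)) (r : ℝ) :
    CarlesonBound ω F s r := by
  obtain ⟨C, hC, hE⟩ := hE
  obtain ⟨N, hN⟩ := exists_nat_gt ((β + 2) / p)
  rw [div_lt_iff₀ hp] at hN
  obtain ⟨C1, hC1, hk⟩ := lintegral_weight_kernel_le hω h hβ0 hβ hN
  set κ := 4 * Real.exp (2 * r) with hκ
  have hκ0 : 0 < κ := by positivity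
  refine ⟨C * C1 ^ s * κ ^ (N * p * s), by positivity, fun z hz => ?_⟩
  have hz' := one_sub_norm_pos hz
  have hw := h.pos_norm hz
  set g : ℂ → ℂ := fun ζ => ((1 - conj z * ζ) ^ N)⁻¹ with hg
  have hgn : ∀ (ζ : ℂ) (y : ℝ), ‖g ζ‖ ^ y = ‖1 - conj z * ζ‖ ^ (-(N * y)) := fun ζ y => by
    rw [hg, norm_inv, norm_pow, ← Real.rpow_natCast, ← Real.rpow_neg (norm_nonneg _),
      ← Real.rpow_mul (norm_nonneg _), neg_mul]
  have hlint : ∫⁻ ζ in UD, ENNReal.ofReal (‖g ζ‖ ^ p * ω ζ) ∂dA ≤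
      ENNReal.ofReal (C1 * (what ω ‖z‖ * (1 - ‖z‖) ^ (1 - N * p))) := by
    refine le_trans (le_of_eq (lintegral_congr fun ζ => ?_)) (hk z hz)
    rw [hgn, mul_comm, ENNReal.ofReal_mul (hω.1 ζ)]
  have hgd : DifferentiableOn ℂ g UD := by
    intro ζ hζ
    have : 1 - conj z * ζ ≠ 0 := norm_pos_iff.1 (norm_one_sub_conj_mul_pos hz hζ)
    have hd : DifferentiableAt ℂ (fun ζ => (1 - conj z * ζ) ^ N) ζ := by fun_prop
    exact (hd.inv (pow_ne_zero _ this)).differentiableWithinAt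
  have hnn : ∀ ζ, 0 ≤ ‖g ζ‖ ^ p * ω ζ := fun ζ => mul_nonneg (by positivity) (hω.1 ζ)
  have hgm : MemAp p ω g := by
    refine ⟨hgd, ?_, ?_⟩
    · exact ((hgd.continuousOn.norm.rpow_const fun _ _ => Or.inr hp.le).aestronglyMeasurable
        measurableSet_UD).mul hω.2.2.aestronglyMeasurable
    · rw [hasFiniteIntegral_iff_ofReal (Filter.Eventually.of_forall hnn)]
      exact hlint.trans_lt ENNReal.ofReal_lt_top
  have hEle : ∫ ζ in UD, ‖g ζ‖ ^ p * ω ζ ∂dA ≤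
      C1 * (what ω ‖z‖ * (1 - ‖z‖) ^ (1 - N * p)) := by
    rwa [← ENNReal.ofReal_le_ofReal_iff (by positivity),
      ofReal_integral_eq_lintegral_ofReal hgm.2 (Filter.Eventually.of_forall hnn)]
  have hE0 : 0 ≤ ∫ ζ in UD, ‖g ζ‖ ^ p * ω ζ ∂dA := integral_nonneg hnn
  have hI0 : 0 ≤ ∫ ζ in hDisc z r, F ζ ∂dA := integral_nonneg hF0
  have hmain : (κ * (1 - ‖z‖)) ^ (-(N * (p * s))) * ∫ ζ in hDisc z r, F ζ ∂dA ≤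
      C * (C1 * (what ω ‖z‖ * (1 - ‖z‖) ^ (1 - N * p))) ^ s := by
    rw [← ENNReal.ofReal_le_ofReal_iff (by positivity), ENNReal.ofReal_mul (by positivity),
      ofReal_setIntegral_hDisc hF0 hF, ← lintegral_const_mul' _ _ ENNReal.ofReal_ne_top]
    calc _ ≤ ∫⁻ ζ in hDisc z r, ENNReal.ofReal (‖g ζ‖ ^ (p * s) * F ζ) ∂dA := by
          refine setLIntegral_mono' (measurableSet_hDisc z r) fun ζ hζ => ?_
          rw [← ENNReal.ofReal_mul (by positivity), hgn]
          refine ENNReal.ofReal_le_ofReal (mul_le_mul_of_nonneg_right ?_ (hF0 ζ))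
          exact Real.rpow_le_rpow_of_nonpos
            (norm_one_sub_conj_mul_pos hz (hDisc_subset_UD z r hζ)) (kernel_le_of_mem_hDisc hz hζ)
            (neg_nonpos.2 (by positivity))
      _ ≤ _ := lintegral_mono_set (hDisc_subset_UD z r)
      _ ≤ _ := hE g hgm
      _ ≤ _ := by gcongr
  rw [Real.rpow_neg (by positivity), inv_mul_le_iff₀ (by positivity)] at hmain
  refine hmain.trans (le_of_eq ?_)
  rw [Real.mul_rpow hC1.le (by positivity), Real.mul_rpow hw.le (by positivity),
    Real.mul_rpow hκ0.le hz'.le, Real.mul_rpow hw.le hz'.le, ← Real.rpow_mul hz'.le]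
  have e1 : (1 - ‖z‖) ^ (N * (p * s)) * (1 - ‖z‖) ^ ((1 - N * p) * s) = (1 - ‖z‖) ^ s := by
    rw [← Real.rpow_add hz']
    ring_nf
  rw [← e1, mul_assoc (N : ℝ)]
  ring

theorem carlesonBound_of_gam_mul_Ber_le {ω ν φ : ℂ → ℝ} {p q c M : ℝ}
    (hq : 0 < q) (h : WhatPos ω) (hν : WhatPos ν) (hc : -1 ≤ c)
    (hF0 : ∀ ζ, 0 ≤ φ ζ * ν ζ) (hF : IntegrableOn (fun ζ => φ ζ * ν ζ) UD dA)
    (hM : ∀ z ∈ UD, gam ω ν p q z ^ q * Ber ν c 1 φ z ≤ M) (r : ℝ) :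
    CarlesonBound ω (fun ζ => φ ζ * ν ζ) (q / p) r := by
  set κ := 4 * Real.exp (2 * r) with hκ
  have hκ0 : 0 < κ := by positivity
  refine ⟨κ * κ ^ (3 + c) * (|M| + 1), by positivity, fun z hz => ?_⟩
  have hz' := one_sub_norm_pos hz
  have hw := h.pos_norm hz
  obtain ⟨q1, q2⟩ := one_sub_norm_sq_comparable hz
  have hMz := hM z hz
  rw [gam_rpow_mul_Ber hq h hν hz, show 2 + c + 1 = 3 + c by ring] at hMz
  simp only [Real.rpow_one] at hMz
  set b : ℂ → ℝ := fun ζ => (1 - ‖ζ‖ ^ 2) * ‖1 - conj z * ζ‖ ^ (-(3 + c)) with hb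
  set I := ∫ ζ in UD, φ ζ * ν ζ * b ζ ∂dA with hI
  have hb0 : ∀ ζ ∈ UD, 0 ≤ b ζ := fun ζ hζ => by
    have := one_sub_norm_pos hζ
    have := (one_sub_norm_sq_comparable hζ).1
    exact mul_nonneg (by linarith) (by positivity)
  have hbm : Measurable b := by fun_prop
  have hint : IntegrableOn (fun ζ => φ ζ * ν ζ * b ζ) UD dA := by
    refine Integrable.mul_bdd (c := (1 - ‖z‖) ^ (-(3 + c))) hF hbm.aestronglyMeasurable ?_
    filter_upwards [ae_restrict_mem measurableSet_UD] with ζ hζ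
    rw [Real.norm_of_nonneg (hb0 ζ hζ)]
    have k1 : 1 - ‖ζ‖ ^ 2 ≤ 1 := by nlinarith
    have k2 : ‖1 - conj z * ζ‖ ^ (-(3 + c)) ≤ (1 - ‖z‖) ^ (-(3 + c)) :=
      Real.rpow_le_rpow_of_nonpos hz' (one_sub_norm_le_kernel hζ) (by linarith)
    calc b ζ ≤ 1 * (1 - ‖z‖) ^ (-(3 + c)) :=
          mul_le_mul k1 k2 (by positivity) zero_le_one
      _ = _ := one_mul _
  have hmain : (1 - ‖z‖) / κ * (κ * (1 - ‖z‖)) ^ (-(3 + c)) * ∫ ζ in hDisc z r, φ ζ * ν ζ ∂dA ≤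
      I := by
    rw [← integral_const_mul]
    calc _ ≤ ∫ ζ in hDisc z r, φ ζ * ν ζ * b ζ ∂dA := by
          refine setIntegral_mono_on ((hF.mono_set (hDisc_subset_UD z r)).const_mul _)
            (hint.mono_set (hDisc_subset_UD z r)) (measurableSet_hDisc z r) fun ζ hζ => ?_
          have hζU := hDisc_subset_UD z r hζ
          rw [mul_comm]
          refine mul_le_mul_of_nonneg_left ?_ (hF0 ζ)
          have k1 : (1 - ‖z‖) / κ ≤ 1 - ‖ζ‖ ^ 2 := by
            refine le_trans ?_ (one_sub_norm_sq_comparable hζU).1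
            rw [div_le_iff₀' hκ0]
            exact one_sub_norm_le_of_mem_hDisc hz hζ
          have k2 : (κ * (1 - ‖z‖)) ^ (-(3 + c)) ≤ ‖1 - conj z * ζ‖ ^ (-(3 + c)) :=
            Real.rpow_le_rpow_of_nonpos (norm_one_sub_conj_mul_pos hz hζU)
              (kernel_le_of_mem_hDisc hz hζ) (by linarith)
          have : 0 < (1 - ‖z‖) / κ := by positivity
          exact mul_le_mul k1 k2 (by positivity) (by linarith)
      _ ≤ _ := setIntegral_mono_set hint
          ((ae_restrict_mem measurableSet_UD).mono fun ζ hζ => mul_nonneg (hF0 ζ) (hb0 ζ hζ))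
          (hDisc_subset_UD z r).eventuallyLE
  have hI0 : 0 ≤ ∫ ζ in hDisc z r, φ ζ * ν ζ ∂dA := integral_nonneg hF0
  have hX : 0 < (what ω ‖z‖ * (1 - ‖z‖)) ^ (q / p) := by positivity
  have hk2 : (1 - ‖z‖) ^ (c + 1) ≤ (1 - ‖z‖ ^ 2) ^ (c + 1) :=
    Real.rpow_le_rpow hz'.le q1 (by linarith)
  have h2 : 0 ≤ (1 - ‖z‖ ^ 2) ^ (c + 1) := Real.rpow_nonneg (by linarith) _
  have hupper : (1 - ‖z‖) * (1 - ‖z‖) ^ (c + 1) / (what ω ‖z‖ * (1 - ‖z‖)) ^ (q / p) *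
      ((1 - ‖z‖) / κ * (κ * (1 - ‖z‖)) ^ (-(3 + c)) * ∫ ζ in hDisc z r, φ ζ * ν ζ ∂dA) ≤
        |M| + 1 := by
    calc _ ≤ (1 - ‖z‖) * (1 - ‖z‖ ^ 2) ^ (c + 1) / (what ω ‖z‖ * (1 - ‖z‖)) ^ (q / p) * I := by
          gcongr
      _ ≤ _ := by linarith [le_abs_self M]
  have e1 : (1 - ‖z‖) * (1 - ‖z‖) ^ (c + 1) / (what ω ‖z‖ * (1 - ‖z‖)) ^ (q / p) *
      ((1 - ‖z‖) / κ * (κ * (1 - ‖z‖)) ^ (-(3 + c)) * ∫ ζ in hDisc z r, φ ζ * ν ζ ∂dA) =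
      (∫ ζ in hDisc z r, φ ζ * ν ζ ∂dA) /
        (κ * κ ^ (3 + c) * (what ω ‖z‖ * (1 - ‖z‖)) ^ (q / p)) := by
    have e2 : (1 - ‖z‖) ^ (3 + c) = (1 - ‖z‖) * (1 - ‖z‖) ^ (c + 1) * (1 - ‖z‖) := by
      rw [show 3 + c = 1 + (c + 1) + 1 by ring, Real.rpow_add hz', Real.rpow_add hz',
        Real.rpow_one]
    rw [Real.rpow_neg (by positivity), Real.mul_rpow hκ0.le hz'.le, e2]
    field_simp
  rw [e1, div_le_iff₀ (by positivity)] at hupper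
  linarith

theorem carlesonBound_of_average {ω ν F : ℂ → ℝ} {p q r M : ℝ} (hq : 0 < q)
    (hω : WhatPos ω) (hν : RadialWeight ν) (hνp : WhatPos ν) (hνD : Dhat ν)
    (hF0 : ∀ ζ, 0 ≤ F ζ) (hpos : ∀ z ∈ UD, 0 < nuD ν z r)
    (hM : ∀ z ∈ UD,
      gam ω ν p q z * ((nuD ν z r)⁻¹ * ∫ ζ in hDisc z r, F ζ ∂dA) ^ (1 / q) ≤ M) :
    CarlesonBound ω F (q / p) r := by
  obtain ⟨C, hC, hup⟩ := exists_nuD_le hν hνp hνD r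
  refine ⟨(|M| ^ q + 1) * C, by positivity, fun z hz => ?_⟩
  have hz' := one_sub_norm_pos hz
  have hw := hω.pos_norm hz
  have hn := hνp.pos_norm hz
  have hd := hpos z hz
  have hg := gam_pos (p := p) (q := q) hω hνp hz
  have hI0 : 0 ≤ ∫ ζ in hDisc z r, F ζ ∂dA := integral_nonneg hF0
  have h1 := Real.rpow_le_rpow (by positivity) ((hM z hz).trans (le_abs_self M)) hq.le
  rw [Real.mul_rpow hg.le (by positivity), ← Real.rpow_mul (by positivity),
    one_div_mul_cancel hq.ne', Real.rpow_one, gam_rpow hq hω hνp hz, div_mul_eq_mul_div,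
    div_le_iff₀ (by positivity)] at h1
  have h2 : (∫ ζ in hDisc z r, F ζ ∂dA) / C ≤
      what ν ‖z‖ * (1 - ‖z‖) * ((nuD ν z r)⁻¹ * ∫ ζ in hDisc z r, F ζ ∂dA) := by
    rw [← mul_assoc, div_eq_inv_mul]
    gcongr
    rw [← div_eq_mul_inv, le_div_iff₀ hd, inv_mul_le_iff₀ hC]
    exact hup z hz
  have h3 := h2.trans h1
  rw [div_le_iff₀ hC] at h3
  refine h3.trans ?_
  have hX : 0 < (what ω ‖z‖ * (1 - ‖z‖)) ^ (q / p) := by positivity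
  rw [mul_right_comm]
  gcongr
  linarith

theorem CarlesonBound.average_le {ω ν F : ℂ → ℝ} {p q r c : ℝ} (hq : 0 < q) (hω : WhatPos ω)
    (hνp : WhatPos ν) (hF0 : ∀ ζ, 0 ≤ F ζ) (hc : 0 < c)
    (hlow : ∀ z ∈ UD, c * (what ν ‖z‖ * (1 - ‖z‖)) ≤ nuD ν z r)
    (hB : CarlesonBound ω F (q / p) r) :
    ∃ M : ℝ, ∀ z ∈ UD,
      gam ω ν p q z * ((nuD ν z r)⁻¹ * ∫ ζ in hDisc z r, F ζ ∂dA) ^ (1 / q) ≤ M := by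
  obtain ⟨C, hC, hB⟩ := hB
  refine ⟨(C / c) ^ (1 / q), fun z hz => ?_⟩
  have hz' := one_sub_norm_pos hz
  have hw := hω.pos_norm hz
  have hn := hνp.pos_norm hz
  have hd : 0 < nuD ν z r := lt_of_lt_of_le (by positivity) (hlow z hz)
  have hg := gam_pos (p := p) (q := q) hω hνp hz
  have hI0 : 0 ≤ ∫ ζ in hDisc z r, F ζ ∂dA := integral_nonneg hF0
  have hgq : gam ω ν p q z = (gam ω ν p q z ^ q) ^ (1 / q) := by
    rw [← Real.rpow_mul hg.le, mul_one_div_cancel hq.ne', Real.rpow_one]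
  rw [hgq, ← Real.mul_rpow (by positivity) (by positivity), gam_rpow hq hω hνp hz]
  refine Real.rpow_le_rpow (by positivity) ?_ (by positivity)
  calc _ ≤ what ν ‖z‖ * (1 - ‖z‖) / (what ω ‖z‖ * (1 - ‖z‖)) ^ (q / p) *
        ((c * (what ν ‖z‖ * (1 - ‖z‖)))⁻¹ * (C * (what ω ‖z‖ * (1 - ‖z‖)) ^ (q / p))) := by
        gcongr
        · exact hlow z hz
        · exact hB z hz
    _ = _ := by field_simp

/-- Lemma 3.4: characterization of the space `BA(Δ)` via the
multiplication operator and the generalized Berezin transform. -/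
theorem BA_iff_multiplier_iff_Berezin (p q : ℝ) (hp : 0 < p) (hpq : p ≤ q)
    (ω ν : ℂ → ℝ) (hω : RadialWeight ω) (hωp : WhatPos ω) (hωD : Dclass ω)
    (hν : RadialWeight ν) (hνp : WhatPos ν) (hνD : Dclass ν)
    (αω βω : ℝ) (hαω : 0 < αω) (hβω : 0 < βω)
    (hαωexp : DcheckExp ω αω) (hβωexp : DhatExp ω βω)
    (f : ℂ → ℂ) (hf : MemLw q ν f) :
    ((∃ r0 > (0 : ℝ), ∀ r : ℝ, r0 ≤ r →
        (∀ z ∈ UD, 0 < nuD ν z r) ∧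
        ∃ M : ℝ, ∀ z ∈ UD,
          gam ω ν p q z *
            ((nuD ν z r)⁻¹ * ∫ ζ in hDisc z r, ‖f ζ‖ ^ q * ν ζ ∂dA) ^ (1 / q) ≤ M) ↔
      (∃ C > (0 : ℝ), ∀ g : ℂ → ℂ, MemAp p ω g →
        (∫⁻ z in UD, ENNReal.ofReal (‖g z‖ ^ q * ‖f z‖ ^ q * ν z) ∂dA) ≤
          ENNReal.ofReal (C * wnorm p ω g ^ q))) ∧
    ((∃ C > (0 : ℝ), ∀ g : ℂ → ℂ, MemAp p ω g →
        (∫⁻ z in UD, ENNReal.ofReal (‖g z‖ ^ q * ‖f z‖ ^ q * ν z) ∂dA) ≤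
          ENNReal.ofReal (C * wnorm p ω g ^ q)) ↔
      (∀ σ c : ℝ, 1 - q / p * (1 + αω) < σ → max (-1 - σ) (q / p * (1 + βω) - 2) < c →
        ∃ M : ℝ, ∀ z ∈ UD,
          gam ω ν p q z ^ q * Ber ν c σ (fun ζ => ‖f ζ‖ ^ q) z ≤ M)) := by
  have hq : 0 < q := hp.trans_le hpq
  have hs : 1 ≤ q / p := (one_le_div hp).2 hpq
  set F : ℂ → ℝ := fun ζ => ‖f ζ‖ ^ q * ν ζ with hF
  have hF0 : ∀ ζ, 0 ≤ F ζ := fun ζ => mul_nonneg (by positivity) (hν.1 ζ)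
  have hFi : IntegrableOn F UD dA := hf.2
  have hb : (∃ C > (0 : ℝ), ∀ g : ℂ → ℂ, MemAp p ω g →
        (∫⁻ z in UD, ENNReal.ofReal (‖g z‖ ^ q * ‖f z‖ ^ q * ν z) ∂dA) ≤
          ENNReal.ofReal (C * wnorm p ω g ^ q)) ↔
      ∃ C > (0 : ℝ), ∀ g : ℂ → ℂ, MemAp p ω g →
        ∫⁻ z in UD, ENNReal.ofReal (‖g z‖ ^ (p * (q / p)) * F z) ∂dA ≤
          ENNReal.ofReal (C * (∫ ζ in UD, ‖g ζ‖ ^ p * ω ζ ∂dA) ^ (q / p)) := by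
    have hn : ∀ g : ℂ → ℂ, wnorm p ω g ^ q = (∫ ζ in UD, ‖g ζ‖ ^ p * ω ζ ∂dA) ^ (q / p) :=
      fun g => by
        rw [wnorm, ← Real.rpow_mul (integral_nonneg fun ζ => mul_nonneg (by positivity) (hω.1 ζ)),
          one_div_mul_eq_div]
    simp only [hn, mul_div_cancel₀ q hp.ne', hF, mul_assoc]
  have hemb : ∀ r, 2 ≤ r → CarlesonBound ω F (q / p) r → _ := fun r hr hB =>
    hB.embedding hω hωp hωD.2 hβω.le hβωexp hp hs hF0 hFi hr
  have htest := carlesonBound_of_embedding (F := F) hp (div_pos hq hp) hω hωp hβω.le hβωexp hF0 hFi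
  rw [hb]
  refine ⟨⟨?_, fun hE => ?_⟩, fun hE σ c hσ hc => ?_, fun hc => ?_⟩
  · rintro ⟨r0, -, h⟩
    obtain ⟨hpos, M, hM⟩ := h (max r0 2) (le_max_left _ _)
    exact hemb _ (le_max_right _ _) (carlesonBound_of_average hq hωp hν hνp hνD.1 hF0 hpos hM)
  · obtain ⟨r0, hr0, c, hc, hlow⟩ := exists_le_nuD hν hνp hνD
    refine ⟨r0, hr0, fun r hr => ⟨fun z hz => ?_, ?_⟩⟩
    · have := one_sub_norm_pos hz
      have := hνp.pos_norm hz
      exact lt_of_lt_of_le (by positivity) (hlow r hr z hz)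
    · exact (htest hE r).average_le hq hωp hνp hF0 hc (hlow r hr)
  · exact (htest hE 2).exists_gam_mul_Ber_le hp hq hωp hαωexp hβωexp hνp hσ hc hF0 hFi le_rfl
  · have h1 := le_max_left (-1 - 1) (q / p * (1 + βω) - 2)
    obtain ⟨M, hM⟩ := hc 1 (max (-1 - 1) (q / p * (1 + βω) - 2) + 1)
      (by have : 0 < q / p * (1 + αω) := by positivity
          linarith) (by linarith)
    exact hemb 2 le_rfl (carlesonBound_of_gam_mul_Ber_le hq hωp hνp (by linarith) hF0 hFi hM 2)
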